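/- arXiv:2404.06088 — 2 statements merged into one kernel-verified Lean document; each statement's English description precedes it below -/
import Mathlib

section
/- For every block configuration B in 𝔽₂^d with rank(B) = 2, the cyclic transversal polytope is exactly the subset of the transversal polytope cut out by the lifted odd-set inequalities: CTP[B] = { x ∈ TP[B] : x satisfies the LOS inequality associated with η and I for every nonzero η ∈ 𝔽₂^d and every I ⊆ [n] of odd cardinality }. -/
open scoped Classical

/-- The field `𝔽₂^d`, represented as functions `Fin d → ZMod 2`. -/
abbrev F2 (d : ℕ) : Type := Fin d → ZMod 2

/-- A cyclic transversal of a block configuration `B`. -/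
def IsCyclicTransversal {d n : ℕ} (B : Fin n → Set (F2 d)) (ξ : Fin n → F2 d) : Prop :=
  (∀ i, ξ i ∈ B i) ∧ (∑ i, ξ i) = 0

/-- The incidence vector of a transversal. -/
noncomputable def incVec {d n : ℕ} (ξ : Fin n → F2 d) : Fin n → F2 d → ℝ :=
  fun i ω => if ξ i = ω then 1 else 0

/-- The cyclic transversal polytope of a block configuration. -/
noncomputable def CTP {d n : ℕ} (B : Fin n → Set (F2 d)) : Set (Fin n → F2 d → ℝ) :=
  convexHull ℝ (incVec '' { ξ | IsCyclicTransversal B ξ })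

/-- The transversal polytope of a block configuration. -/
def TP {d n : ℕ} (B : Fin n → Set (F2 d)) : Set (Fin n → F2 d → ℝ) :=
  { x | (∀ i ω, 0 ≤ x i ω) ∧ (∀ i ω, ω ∉ B i → x i ω = 0) ∧ ∀ i, (∑ ω : F2 d, x i ω) = 1 }

/-- The size of a block configuration. -/
noncomputable def blockSize {d n : ℕ} (B : Fin n → Set (F2 d)) : ℕ := ∑ i, (B i).ncard

/-- The rank of a block configuration. -/
noncomputable def blockRank {d n : ℕ} (B : Fin n → Set (F2 d)) : ℕ :=
  Module.finrank (ZMod 2) (Submodule.span (ZMod 2) (⋃ i, B i))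

/-- Two sets of real vectors are affinely isomorphic. -/
def AffIso {α β : Type*} [AddCommGroup α] [Module ℝ α] [AddCommGroup β] [Module ℝ β]
    (P : Set α) (Q : Set β) : Prop :=
  ∃ f : α →ᵃ[ℝ] β, Set.InjOn f P ∧ f '' P = Q

/-- The left-hand side of the lifted odd-set (LOS) inequality associated with `η` and `I`. -/
noncomputable def losLHS {d n : ℕ} (B : Fin n → Set (F2 d)) (η : F2 d) (I : Finset (Fin n))
    (x : Fin n → F2 d → ℝ) : ℝ :=
  (∑ i ∈ I, ∑ ω ∈ Finset.univ.filter (fun ω : F2 d => ω ∈ B i ∧ (∑ j, η j * ω j) = 0), x i ω) +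
  (∑ i ∈ Iᶜ, ∑ ω ∈ Finset.univ.filter (fun ω : F2 d => ω ∈ B i ∧ (∑ j, η j * ω j) = 1), x i ω)


def tmv (i : ZMod 2) (y : ℝ) : ℝ := if i = 1 then 1 - y else y
def sgv (i : ZMod 2) (z : ℝ) : ℝ := if i = 1 then - z else z

lemma zm2 (i : ZMod 2) : i = 0 ∨ i = 1 := by revert i; decide

section star
variable {E : Type*} 

def Dd (S : Finset E) (I : E → ZMod 2) (y : E → ℝ) : ℝ := ∑ e ∈ S, tmv (I e) (y e)
def Ff (S : Finset E) (I : E → ZMod 2) (z : E → ℝ) : ℝ := ∑ e ∈ S, sgv (I e) (z e)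

def PPs (S : Finset E) (y : E → ℝ) : Prop :=
  ∀ I : E → ZMod 2, ∑ e ∈ S, I e = 1 → 1 ≤ Dd S I y

lemma tmv_nonneg {i : ZMod 2} {y : ℝ} (h0 : 0 ≤ y) (h1 : y ≤ 1) : 0 ≤ tmv i y := by
  unfold tmv; split_ifs <;> linarith

lemma Dd_add (S : Finset E) (I : E → ZMod 2) (y z : E → ℝ) (t : ℝ) :
    Dd S I (fun e => y e + t * z e) = Dd S I y + t * Ff S I z := by
  unfold Dd Ff
  rw [Finset.mul_sum, ← Finset.sum_add_distrib]
  refine Finset.sum_congr rfl fun e _ => ?_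
  unfold tmv sgv; split_ifs <;> ring

lemma lemA (S : Finset E) (y z : E → ℝ) (hb : ∀ e, 0 ≤ y e ∧ y e ≤ 1)
    (I J : E → ZMod 2) (hI : ∑ e ∈ S, I e = 1) (hJ : ∑ e ∈ S, J e = 1)
    (tI : Dd S I y = 1) (tJ : Dd S J y = 1)
    (hz : ∀ e, (y e = 0 ∨ y e = 1) → z e = 0) (h : Ff S I z = 0) : Ff S J z = 0 := by
  by_cases hIJ : ∀ e ∈ S, I e = J e
  · rw [← h]; unfold Ff
    exact Finset.sum_congr rfl fun e he => by rw [hIJ e he]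
  push Not at hIJ
  obtain ⟨a, haS, ha⟩ := hIJ
  have hb' : ∃ b ∈ S.erase a, I b ≠ J b := by
    by_contra hc
    push Not at hc
    have h1 := Finset.add_sum_erase S I haS
    have h2 := Finset.add_sum_erase S J haS
    rw [Finset.sum_congr rfl hc] at h1
    apply ha
    rw [hI] at h1; rw [hJ, ← h1] at h2
    exact (add_right_cancel h2).symm
  obtain ⟨b, hbS, hbne⟩ := hb'
  have eqv : ∀ g : E → ℝ, ∑ e ∈ S, g e = g a + (g b + ∑ e ∈ (S.erase a).erase b, g e) := by
    intro g
    rw [Finset.add_sum_erase _ _ hbS, Finset.add_sum_erase _ _ haS]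
  unfold Dd at tI tJ
  rw [eqv] at tI tJ
  have key : ∀ i j : ZMod 2, i ≠ j → ∀ r, tmv i r + tmv j r = 1 := by
    intro i j hij r
    rcases zm2 i with rfl | rfl <;> rcases zm2 j with rfl | rfl <;>
      first | exact absurd rfl hij | norm_num [tmv]
  have key2 : ∀ i j : ZMod 2, i ≠ j → ∀ r, sgv j r = - sgv i r := by
    intro i j hij r
    rcases zm2 i with rfl | rfl <;> rcases zm2 j with rfl | rfl <;>
      first | exact absurd rfl hij | norm_num [sgv]
  have k1 := key _ _ ha (y a)
  have k2 := key _ _ hbne (y b)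
  have nn : ∀ e ∈ (S.erase a).erase b, 0 ≤ tmv (I e) (y e) := fun e _ => tmv_nonneg (hb e).1 (hb e).2
  have nnJ : ∀ e ∈ (S.erase a).erase b, 0 ≤ tmv (J e) (y e) := fun e _ => tmv_nonneg (hb e).1 (hb e).2
  have s0 : ∑ e ∈ (S.erase a).erase b, tmv (I e) (y e) = 0 := by
    have := Finset.sum_nonneg nn
    have := Finset.sum_nonneg nnJ
    linarith
  rw [Finset.sum_eq_zero_iff_of_nonneg nn] at s0
  have z0 : ∀ e ∈ (S.erase a).erase b, z e = 0 := by
    intro e he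
    apply hz
    have := s0 e he
    unfold tmv at this
    split_ifs at this
    · right; linarith
    · left; exact this
  have f0 : ∀ K : E → ZMod 2, ∑ e ∈ (S.erase a).erase b, sgv (K e) (z e) = 0 := by
    intro K
    apply Finset.sum_eq_zero
    intro e he
    rw [z0 e he]; simp [sgv]
  unfold Ff at h ⊢
  rw [eqv, f0] at h ⊢
  rw [key2 _ _ ha, key2 _ _ hbne]
  linarith

lemma lemB [Finite E] (S : Finset E) (y z : E → ℝ) (hP : PPs S y)
    (ht : ∀ I : E → ZMod 2, ∑ e ∈ S, I e = 1 → Dd S I y = 1 → Ff S I z = 0) :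
    ∃ ε > 0, ∀ t : ℝ, |t| ≤ ε → PPs S (fun e => y e + t * z e) := by
  have : ∀ I : E → ZMod 2, ∃ ε > 0, ∀ t : ℝ, |t| ≤ ε → ∑ e ∈ S, I e = 1 →
      1 ≤ Dd S I y + t * Ff S I z := by
    intro I
    by_cases hI : ∑ e ∈ S, I e = 1
    · rcases (hP I hI).eq_or_lt with h | h
      · refine ⟨1, one_pos, fun t _ _ => ?_⟩
        rw [ht I hI h.symm]; linarith
      · refine ⟨(Dd S I y - 1) / (|Ff S I z| + 1), by apply div_pos <;> [linarith; positivity], ?_⟩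
        intro t htt _
        rw [le_div_iff₀ (by positivity)] at htt
        have h1 : |t * Ff S I z| ≤ Dd S I y - 1 := by
          rw [abs_mul]; nlinarith [abs_nonneg t, abs_nonneg (Ff S I z)]
        have := (abs_le.1 h1).1
        linarith
    · exact ⟨1, one_pos, fun t _ h => absurd h hI⟩
  choose ε h0 hε using this
  obtain ⟨I0, hI0⟩ := Finite.exists_min ε
  refine ⟨ε I0, h0 _, fun t htt I hI => ?_⟩
  rw [Dd_add]
  exact hε I t (htt.trans (hI0 I)) hI

lemma lemC (S : Finset E) (y : E → ℝ) (hb : ∀ e, 0 ≤ y e ∧ y e ≤ 1) (hP : PPs S y)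
    (a : E) (ha : a ∈ S) (h0 : y a ≠ 0) (h1 : y a ≠ 1) :
    ∃ b ∈ S, b ≠ a ∧ y b ≠ 0 ∧ y b ≠ 1 := by
  by_contra hc
  push Not at hc
  let I0 : E → ZMod 2 := fun e => if y e = 1 then 1 else 0
  let I : E → ZMod 2 := fun e => if e = a then 1 - ∑ e ∈ S.erase a, I0 e else I0 e
  have hs : ∑ e ∈ S.erase a, I e = ∑ e ∈ S.erase a, I0 e := by
    refine Finset.sum_congr rfl fun e he => ?_
    simp [I, Finset.ne_of_mem_erase he]
  have hI : ∑ e ∈ S, I e = 1 := by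
    rw [← Finset.add_sum_erase S I ha, hs]
    simp [I]
  have := hP I hI
  unfold Dd at this
  rw [← Finset.add_sum_erase S _ ha, Finset.sum_eq_zero (s := S.erase a)] at this
  · have l0 := lt_of_le_of_ne (hb a).1 (Ne.symm h0)
    have l1 := lt_of_le_of_ne (hb a).2 h1
    unfold tmv at this
    split_ifs at this <;> linarith
  · intro e he
    have hne := Finset.ne_of_mem_erase he
    have := hc e (Finset.mem_of_mem_erase he) hne
    by_cases h : y e = 1
    · simp [I, I0, hne, h, tmv]
    · have h' : y e = 0 := by by_contra hh; exact h (this hh)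
      simp [I, I0, hne, h', tmv]

lemma lemD (S : Finset E) (y : E → ℝ) (hb : ∀ e, 0 ≤ y e ∧ y e ≤ 1)
    (m : E → ZMod 2) (hm : ∑ e ∈ S, m e = 0) (a b : E) (hab : a ≠ b) (ha : a ∈ S) (hbS : b ∈ S)
    (h0 : y a ≠ 0) (h1 : y a ≠ 1)
    (hval : ∀ e ∈ S, e ≠ a → e ≠ b → y e = if m e = 1 then 1 else 0)
    (z : E → ℝ) (hz0 : ∀ e ∈ S, e ≠ a → e ≠ b → z e = 0)
    (za : z a = if m a = 1 then -1 else 1) (zb : z b = if m b = 1 then -1 else 1)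
    (I : E → ZMod 2) (hI : ∑ e ∈ S, I e = 1) (tI : Dd S I y = 1) : Ff S I z = 0 := by
  have hbS' : b ∈ S.erase a := Finset.mem_erase.2 ⟨hab.symm, hbS⟩
  have eqv : ∀ g : E → ℝ, ∑ e ∈ S, g e = g a + (g b + ∑ e ∈ (S.erase a).erase b, g e) := by
    intro g
    rw [Finset.add_sum_erase _ _ hbS', Finset.add_sum_erase _ _ ha]
  have eqv2 : ∀ g : E → ZMod 2, ∑ e ∈ S, g e = g a + (g b + ∑ e ∈ (S.erase a).erase b, g e) := by
    intro g
    rw [Finset.add_sum_erase _ _ hbS', Finset.add_sum_erase _ _ ha]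
  have l0 := lt_of_le_of_ne (hb a).1 (Ne.symm h0)
  have l1 := lt_of_le_of_ne (hb a).2 h1
  have hT : ∀ e ∈ (S.erase a).erase b, e ∈ S ∧ e ≠ a ∧ e ≠ b := by
    intro e he; simp at he; tauto
  have hIm : ∀ e ∈ (S.erase a).erase b, I e = m e := by
    intro e he
    by_contra hne
    obtain ⟨hS, hea, heb⟩ := hT e he
    have t1 : tmv (I e) (y e) = 1 := by
      rw [hval e hS hea heb]
      rcases zm2 (I e) with h | h <;> rcases zm2 (m e) with h' | h' <;> rw [h, h'] at hne ⊢ <;>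
      first | exact absurd rfl hne | norm_num [tmv]
    unfold Dd at tI
    rw [eqv] at tI
    have := Finset.single_le_sum (f := fun e => tmv (I e) (y e)) (fun e _ => tmv_nonneg (hb e).1 (hb e).2) he
    have p1 : 0 < tmv (I a) (y a) := by unfold tmv; split_ifs <;> linarith
    have p2 : 0 ≤ tmv (I b) (y b) := tmv_nonneg (hb b).1 (hb b).2
    simp only [t1] at this
    linarith
  rw [eqv2, Finset.sum_congr rfl hIm] at hI
  rw [eqv2] at hm
  have hx : I a + I b + m a + m b = 1 := by
    generalize ∑ e ∈ (S.erase a).erase b, m e = s at *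
    generalize I a = p at *
    generalize I b = q at *
    generalize m a = p' at *
    generalize m b = q' at *
    clear * - hI hm
    revert p q p' q' s; decide
  unfold Ff
  rw [eqv, Finset.sum_eq_zero (s := (S.erase a).erase b), za, zb]
  · generalize I a = p at *
    generalize I b = q at *
    generalize m a = p' at *
    generalize m b = q' at *
    clear * - hx
    rcases zm2 p with rfl | rfl <;> rcases zm2 q with rfl | rfl <;> rcases zm2 p' with rfl | rfl <;>
      rcases zm2 q' with rfl | rfl <;> first | (exfalso; revert hx; decide) | norm_num [sgv]
  · intro e he
    obtain ⟨hS, hea, heb⟩ := hT e he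
    rw [hz0 e hS hea heb]; simp [sgv]

lemma lemE (S : Finset E) (y : E → ℝ) (hP : PPs S y) (m : E → ZMod 2)
    (hval : ∀ e ∈ S, y e = if m e = 1 then 1 else 0) : ∑ e ∈ S, m e = 0 := by
  rcases zm2 (∑ e ∈ S, m e) with h | h
  · exact h
  · exfalso
    have := hP m h
    unfold Dd at this
    rw [Finset.sum_eq_zero] at this
    · linarith
    · intro e he
      rw [hval e he]
      rcases zm2 (m e) with h' | h' <;> simp [h', tmv]
end star

section graph
variable {n : ℕ}

def inc (n : ℕ) : Fin n ⊕ Fin 3 → Finset (Fin n × Fin 3)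
  | Sum.inl i => Finset.univ.filter (fun e => e.1 = i)
  | Sum.inr j => Finset.univ.filter (fun e => e.2 = j)

lemma sum_inl {M : Type*} [AddCommMonoid M] (g : Fin n × Fin 3 → M) (i : Fin n) :
    ∑ e ∈ inc n (Sum.inl i), g e = ∑ j, g (i, j) := by
  simp only [inc, Finset.sum_filter]
  rw [Fintype.sum_prod_type, Finset.sum_eq_single i]
  · simp
  · intro b _ hb; simp [hb]
  · simp

lemma sum_inr {M : Type*} [AddCommMonoid M] (g : Fin n × Fin 3 → M) (j : Fin 3) :
    ∑ e ∈ inc n (Sum.inr j), g e = ∑ i, g (i, j) := by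
  simp only [inc, Finset.sum_filter]
  rw [Fintype.sum_prod_type_right, Finset.sum_eq_single j]
  · simp
  · intro b _ hb; simp [hb]
  · simp

def PS (n : ℕ) : Set (Fin n × Fin 3 → ℝ) :=
  {y | (∀ e, 0 ≤ y e ∧ y e ≤ 1) ∧ ∀ v, PPs (inc n v) y}

def frac (y : Fin n × Fin 3 → ℝ) (e : Fin n × Fin 3) : Prop := y e ≠ 0 ∧ y e ≠ 1

def qq (i : Fin n) (a b : Fin 3) : Fin n × Fin 3 → ZMod 2 :=
  fun e => (if e = (i, a) then 1 else 0) + (if e = (i, b) then 1 else 0)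

lemma qq_row (i : Fin n) (a b : Fin 3) (i' : Fin n) : ∑ j, qq i a b (i', j) = 0 := by
  unfold qq
  rw [Finset.sum_add_distrib]
  by_cases h : i' = i
  · subst h; simp; decide
  · simp [h]

lemma qq_col (i : Fin n) (a b : Fin 3) (j : Fin 3) :
    ∑ i', qq i a b (i', j) = (if j = a then 1 else 0) + (if j = b then 1 else 0) := by
  unfold qq
  rw [Finset.sum_add_distrib]
  congr 1
  · by_cases h : j = a <;> simp [h]
  · by_cases h : j = b <;> simp [h]

lemma row_other {y : Fin n × Fin 3 → ℝ} (hy : y ∈ PS n) {i : Fin n} {a : Fin 3}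
    (h : frac y (i, a)) : ∃ b, b ≠ a ∧ frac y (i, b) := by
  obtain ⟨⟨i', b⟩, hb, hne, h0, h1⟩ := lemC _ y hy.1 (hy.2 (Sum.inl i)) (i, a) (by simp [inc]) h.1 h.2
  simp [inc] at hb
  subst hb
  exact ⟨b, fun hh => hne (by rw [hh]), h0, h1⟩

lemma path {y : Fin n × Fin 3 → ℝ} (hy : y ∈ PS n) {i j : Fin n} {a b : Fin 3} (hab : a ≠ b)
    (ha : frac y (i, a)) (hb : frac y (j, b)) :
    ∃ p : Fin n × Fin 3 → ZMod 2, (∀ e, ¬ frac y e → p e = 0) ∧ (∀ i, ∑ j, p (i, j) = 0) ∧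
      ∀ j, ∑ i, p (i, j) = (if j = a then 1 else 0) + (if j = b then 1 else 0) := by
  have supp : ∀ i a b, frac y (i, a) → frac y (i, b) → ∀ e, ¬ frac y e → qq i a b e = 0 := by
    intro i a b h1 h2 e he
    have e1 : e ≠ (i, a) := by rintro rfl; exact he h1
    have e2 : e ≠ (i, b) := by rintro rfl; exact he h2
    simp [qq, e1, e2]
  obtain ⟨c, hca, hc⟩ := row_other hy ha
  by_cases hcb : c = b
  · subst hcb
    exact ⟨qq i a c, supp _ _ _ ha hc, qq_row i a c, qq_col i a c⟩
  obtain ⟨c', hcb', hc'⟩ := row_other hy hb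
  by_cases hca' : c' = a
  · subst hca'
    exact ⟨qq j c' b, supp _ _ _ hc' hb, qq_row _ _ _, qq_col _ _ _⟩
  have : c' = c := by omega
  subst this
  refine ⟨fun e => qq i a c' e + qq j c' b e, ?_, ?_, ?_⟩
  · intro e he
    beta_reduce
    rw [supp _ _ _ ha hc e he, supp _ _ _ hc' hb e he, add_zero]
  · intro k
    rw [Finset.sum_add_distrib, qq_row, qq_row, add_zero]
  · intro k
    rw [Finset.sum_add_distrib, qq_col, qq_col]
    generalize (if k = a then (1 : ZMod 2) else 0) = p
    generalize (if k = b then (1 : ZMod 2) else 0) = q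
    generalize (if k = c' then (1 : ZMod 2) else 0) = r
    revert p q r; decide

lemma three_cases : ∀ c : Fin 3 → ZMod 2, c 0 + c 1 + c 2 = 0 → (∀ j, c j = 0) ∨
    ∃ a b, a ≠ b ∧ c a ≠ 0 ∧ c b ≠ 0 ∧
      ∀ j, c j = (if j = a then 1 else 0) + (if j = b then 1 else 0) := by
  decide

lemma lemM {y : Fin n × Fin 3 → ℝ} (hy : y ∈ PS n) :
    ∃ m : Fin n × Fin 3 → ZMod 2, (∀ v, ∑ e ∈ inc n v, m e = 0) ∧
      ∀ e, ¬ frac y e → y e = if m e = 1 then 1 else 0 := by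
  let base : Fin n × Fin 3 → ZMod 2 := fun e => if y e = 1 then 1 else 0
  have hbase : ∀ e, ¬ frac y e → y e = if base e = 1 then 1 else 0 := by
    intro e he
    by_cases h : y e = 1
    · simp [base, h]
    · have : y e = 0 := by by_contra hh; exact he ⟨hh, h⟩
      simp [base, this]
  have hrow : ∀ i, ∃ r : Fin 3 → ZMod 2, ∑ j, r j = 0 ∧
      ∀ j, ¬ frac y (i, j) → r j = base (i, j) := by
    intro i
    by_cases h : ∃ j, frac y (i, j)
    · obtain ⟨j, hj⟩ := h
      refine ⟨fun j' => base (i, j') + if j' = j then ∑ k, base (i, k) else 0, ?_, ?_⟩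
      · rw [Finset.sum_add_distrib]
        simp
        generalize ∑ k, base (i, k) = s
        revert s; decide
      · intro j' hj'
        have : j' ≠ j := by rintro rfl; exact hj' hj
        simp [this]
    · push Not at h
      refine ⟨fun j => base (i, j), ?_, fun j _ => rfl⟩
      rw [← sum_inl]
      apply lemE _ y (hy.2 _)
      rintro ⟨i', j⟩ he
      simp [inc] at he
      subst he
      exact hbase _ (h j)
  choose r hr0 hr using hrow
  let m0 : Fin n × Fin 3 → ZMod 2 := fun e => r e.1 e.2
  have hm0 : ∀ e, ¬ frac y e → y e = if m0 e = 1 then 1 else 0 := by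
    intro e he
    have : m0 e = base e := hr e.1 e.2 he
    rw [this]; exact hbase e he
  let c : Fin 3 → ZMod 2 := fun j => ∑ i, m0 (i, j)
  have hc : c 0 + c 1 + c 2 = 0 := by
    have : ∑ j, c j = 0 := by
      simp only [c]
      rw [Finset.sum_comm]
      exact Finset.sum_eq_zero fun i _ => hr0 i
    rwa [Fin.sum_univ_three] at this
  have hcf : ∀ j, c j ≠ 0 → ∃ i, frac y (i, j) := by
    intro j hj
    by_contra hno
    push Not at hno
    apply hj
    simp only [c]
    rw [← sum_inr]
    apply lemE _ y (hy.2 _)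
    rintro ⟨i, j'⟩ he
    simp [inc] at he
    subst he
    exact hm0 _ (hno i)
  rcases three_cases c hc with h | ⟨a, b, hab, ha, hb, hcc⟩
  · refine ⟨m0, ?_, hm0⟩
    rintro (i | j)
    · rw [sum_inl]; exact hr0 i
    · rw [sum_inr]; exact h j
  · obtain ⟨i, hi⟩ := hcf a ha
    obtain ⟨j, hj⟩ := hcf b hb
    obtain ⟨p, hp0, hpr, hpc⟩ := path hy hab hi hj
    refine ⟨fun e => m0 e + p e, ?_, ?_⟩
    · rintro (i | j)
      · rw [sum_inl, Finset.sum_add_distrib, hpr, add_zero]; exact hr0 i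
      · rw [sum_inr, Finset.sum_add_distrib, hpc, ← hcc]
        change c j + c j = 0
        generalize c j = s
        revert s; decide
    · intro e he
      beta_reduce
      rw [hp0 e he, add_zero]; exact hm0 e he

lemma lemStep {y z : Fin n × Fin 3 → ℝ} (hy : y ∈ PS n) (hz : ∀ e, ¬ frac y e → z e = 0)
    (ht : ∀ v, ∀ I : Fin n × Fin 3 → ZMod 2, ∑ e ∈ inc n v, I e = 1 → Dd (inc n v) I y = 1 →
      Ff (inc n v) I z = 0) :
    ∃ ε > 0, ∀ t : ℝ, |t| ≤ ε → (fun e => y e + t * z e) ∈ PS n := by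
  have h1 : ∀ v, ∃ ε > 0, ∀ t : ℝ, |t| ≤ ε → PPs (inc n v) (fun e => y e + t * z e) :=
    fun v => lemB _ y z (hy.2 v) (ht v)
  have h2 : ∀ e, ∃ ε > 0, ∀ t : ℝ, |t| ≤ ε → 0 ≤ y e + t * z e ∧ y e + t * z e ≤ 1 := by
    intro e
    by_cases he : frac y e
    · have l0 := lt_of_le_of_ne (hy.1 e).1 (Ne.symm he.1)
      have l1 := lt_of_le_of_ne (hy.1 e).2 he.2
      refine ⟨min (y e) (1 - y e) / (|z e| + 1), ?_, ?_⟩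
      · apply div_pos
        · apply lt_min <;> linarith
        · positivity
      · intro t htt
        rw [le_div_iff₀ (by positivity)] at htt
        have h1 : |t * z e| ≤ min (y e) (1 - y e) := by
          rw [abs_mul]; nlinarith [abs_nonneg t, abs_nonneg (z e)]
        have := abs_le.1 (h1.trans (min_le_left _ _))
        have := abs_le.1 (h1.trans (min_le_right _ _))
        constructor <;> linarith
    · refine ⟨1, one_pos, fun t _ => ?_⟩
      rw [hz e he]; simpa using hy.1 e
  choose ε1 p1 q1 using h1
  choose ε2 p2 q2 using h2
  obtain ⟨v0, hv0⟩ := Finite.exists_min ε1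
  by_cases hE : Nonempty (Fin n × Fin 3)
  · obtain ⟨e0, he0⟩ := Finite.exists_min ε2
    refine ⟨min (ε1 v0) (ε2 e0), lt_min (p1 _) (p2 _), fun t htt => ⟨fun e => ?_, fun v => ?_⟩⟩
    · exact q2 e t (htt.trans ((min_le_right _ _).trans (he0 e)))
    · exact q1 v t (htt.trans ((min_le_left _ _).trans (hv0 v)))
  · refine ⟨ε1 v0, p1 _, fun t htt => ⟨fun e => (hE ⟨e⟩).elim, fun v => ?_⟩⟩
    exact q1 v t (htt.trans (hv0 v))

noncomputable def dg (y : Fin n × Fin 3 → ℝ) (v : Fin n ⊕ Fin 3) : ℕ :=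
  ((inc n v).filter (fun e => frac y e)).card

lemma dg_sum (y : Fin n × Fin 3 → ℝ) :
    ∑ v, dg y v = 2 * Fintype.card {e // frac y e} := by
  have : ∀ v, dg y v = ∑ e ∈ inc n v, if frac y e then 1 else 0 := by
    intro v; simp [dg]
  simp only [this, Fintype.sum_sum_type, sum_inl, sum_inr]
  rw [Finset.sum_comm (s := (Finset.univ : Finset (Fin 3))), ← two_mul, ← Fintype.sum_prod_type (f := fun e : Fin n × Fin 3 => if frac y e then 1 else 0)]
  rw [Fintype.card_subtype]; simp

lemma dg_ne_one {y : Fin n × Fin 3 → ℝ} (hy : y ∈ PS n) (v : Fin n ⊕ Fin 3) (h : dg y v ≠ 0) :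
    2 ≤ dg y v := by
  unfold dg at h ⊢
  obtain ⟨a, ha⟩ := Finset.card_ne_zero.1 h
  obtain ⟨haS, hf⟩ := Finset.mem_filter.1 ha
  obtain ⟨b, hb, hne, h0, h1⟩ := lemC _ y hy.1 (hy.2 v) a haS hf.1 hf.2
  exact Finset.one_lt_card.2 ⟨a, ha, b, Finset.mem_filter.2 ⟨hb, h0, h1⟩, hne.symm⟩

lemma perturb {y : Fin n × Fin 3 → ℝ} (hy : y ∈ PS n) (hf : ∃ e, frac y e) :
    ∃ z : Fin n × Fin 3 → ℝ, z ≠ 0 ∧ (∀ e, ¬ frac y e → z e = 0) ∧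
    (∀ v, ∀ I : Fin n × Fin 3 → ZMod 2, ∑ e ∈ inc n v, I e = 1 → Dd (inc n v) I y = 1 →
      Ff (inc n v) I z = 0) := by
  by_cases hd : ∀ v, dg y v ≤ 2
  · obtain ⟨m, hm, hmy⟩ := lemM hy
    obtain ⟨e0, he0⟩ := hf
    let z : Fin n × Fin 3 → ℝ := fun e => if frac y e then (if m e = 1 then -1 else 1) else 0
    have hz : ∀ e, ¬ frac y e → z e = 0 := fun e he => by simp [z, he]
    refine ⟨z, ?_, hz, ?_⟩
    · intro h
      have := congrFun h e0
      simp only [z, he0, if_true, Pi.zero_apply] at this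
      split_ifs at this <;> norm_num at this
    · intro v I hI tI
      by_cases h0 : dg y v = 0
      · unfold Ff
        apply Finset.sum_eq_zero
        intro e he
        rw [hz e]
        · simp [sgv]
        · intro hfe
          have := Finset.card_eq_zero.1 h0
          have hmem := Finset.mem_filter.2 ⟨he, hfe⟩
          rw [this] at hmem
          simp at hmem
      · have h2 : dg y v = 2 := le_antisymm (hd v) (dg_ne_one hy v h0)
        obtain ⟨a, b, hab, hS⟩ := Finset.card_eq_two.1 h2
        have ha : a ∈ (inc n v).filter (fun e => frac y e) := by rw [hS]; simp
        have hb : b ∈ (inc n v).filter (fun e => frac y e) := by rw [hS]; simp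
        rw [Finset.mem_filter] at ha hb
        have hnf : ∀ e ∈ inc n v, e ≠ a → e ≠ b → ¬ frac y e := by
          intro e he hea heb hfe
          have hmem := Finset.mem_filter.2 ⟨he, hfe⟩
          rw [hS] at hmem
          simp [hea, heb] at hmem
        refine lemD _ y hy.1 m (hm v) a b hab ha.1 hb.1 ha.2.1 ha.2.2
          (fun e he h1 h2 => hmy e (hnf e he h1 h2)) z (fun e he h1 h2 => hz e (hnf e he h1 h2))
          ?_ ?_ I hI tI
        · simp [z, ha.2]
        · simp [z, hb.2]
  · push Not at hd
    obtain ⟨v0, hv0⟩ := hd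
    let W := {v : Fin n ⊕ Fin 3 // dg y v ≠ 0}
    let F := {e : Fin n × Fin 3 // frac y e}
    have hcard : Fintype.card W < Fintype.card F := by
      have h1 := dg_sum y
      have h2 : ∑ v, (if dg y v ≠ 0 then 2 else 0) < ∑ v, dg y v := by
        apply Finset.sum_lt_sum
        · intro v _
          split_ifs with h
          · exact dg_ne_one hy v h
          · simp
        · refine ⟨v0, Finset.mem_univ _, ?_⟩
          split_ifs <;> omega
      have h3 : ∑ v, (if dg y v ≠ 0 then 2 else 0) = 2 * Fintype.card W := by
        rw [Fintype.card_subtype, ← Finset.sum_filter]; simp [mul_comm]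
      have h4 : Fintype.card F = Fintype.card {e // frac y e} := rfl
      omega
    let J : Fin n ⊕ Fin 3 → Fin n × Fin 3 → ZMod 2 := fun v =>
      if h : ∃ I : Fin n × Fin 3 → ZMod 2, ∑ e ∈ inc n v, I e = 1 ∧ Dd (inc n v) I y = 1
      then h.choose else 0
    let ext : (F → ℝ) → (Fin n × Fin 3 → ℝ) := fun z e => if h : frac y e then z ⟨e, h⟩ else 0
    let L : (F → ℝ) →ₗ[ℝ] (W → ℝ) :=
      { toFun := fun z v => Ff (inc n v.1) (J v.1) (ext z)
        map_add' := by
          intro z w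
          funext v
          simp only [Ff, Pi.add_apply, ← Finset.sum_add_distrib]
          refine Finset.sum_congr rfl fun e _ => ?_
          simp only [sgv, ext]
          split_ifs <;> simp <;> ring
        map_smul' := by
          intro c w
          funext v
          simp only [Ff, Pi.smul_apply, smul_eq_mul, Finset.mul_sum, RingHom.id_apply]
          refine Finset.sum_congr rfl fun e _ => ?_
          simp only [sgv, ext]
          split_ifs <;> simp }
    have hker : LinearMap.ker L ≠ ⊥ := by
      apply LinearMap.ker_ne_bot_of_finrank_lt
      simpa using hcard
    obtain ⟨z, hzk, hz0⟩ := (Submodule.ne_bot_iff _).1 hker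
    have hext : ∀ e, ¬ frac y e → ext z e = 0 := fun e he => by simp [ext, he]
    refine ⟨ext z, ?_, hext, ?_⟩
    · intro h
      apply hz0
      funext f
      have := congrFun h f.1
      simpa [ext, f.2] using this
    · intro v I hI tI
      by_cases h0 : dg y v = 0
      · unfold Ff
        apply Finset.sum_eq_zero
        intro e he
        rw [hext e]
        · simp [sgv]
        · intro hfe
          have := Finset.card_eq_zero.1 h0
          have hmem := Finset.mem_filter.2 ⟨he, hfe⟩
          rw [this] at hmem
          simp at hmem
      · have hex : ∃ I : Fin n × Fin 3 → ZMod 2, ∑ e ∈ inc n v, I e = 1 ∧ Dd (inc n v) I y = 1 :=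
          ⟨I, hI, tI⟩
        have hJ : J v = hex.choose := by simp only [J]; rw [dif_pos hex]
        have hJ1 : ∑ e ∈ inc n v, J v e = 1 := by rw [hJ]; exact hex.choose_spec.1
        have hJ2 : Dd (inc n v) (J v) y = 1 := by rw [hJ]; exact hex.choose_spec.2
        refine lemA _ y (ext z) hy.1 (J v) I hJ1 hI hJ2 tI ?_ ?_
        · intro e he
          apply hext
          rintro ⟨h1, h2⟩
          rcases he with he | he
          · exact h1 he
          · exact h2 he
        · have : L z = 0 := hzk
          exact congrFun this ⟨v, h0⟩

def EvenSet (n : ℕ) : Set (Fin n × Fin 3 → ZMod 2) := {m | ∀ v, ∑ e ∈ inc n v, m e = 0}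

def bits (m : Fin n × Fin 3 → ZMod 2) : Fin n × Fin 3 → ℝ := fun e => if m e = 1 then 1 else 0

lemma ext_int {y : Fin n × Fin 3 → ℝ} (hy : y ∈ (PS n).extremePoints ℝ) :
    y ∈ bits '' EvenSet n := by
  have hyP := hy.1
  by_cases hf : ∃ e, frac y e
  · exfalso
    obtain ⟨z, hz0, hz, ht⟩ := perturb hyP hf
    obtain ⟨ε, hε, h⟩ := lemStep hyP hz ht
    have h1 := h ε (by rw [abs_of_pos hε])
    have h2 := h (-ε) (by rw [abs_neg, abs_of_pos hε])
    have hseg : y ∈ openSegment ℝ (fun e => y e + ε * z e) (fun e => y e + -ε * z e) := by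
      refine ⟨1/2, 1/2, by norm_num, by norm_num, by norm_num, ?_⟩
      funext e
      simp; ring
    have := hy.2 h1 h2 hseg
    apply hz0
    funext e
    have := congrFun this e
    simp at this
    rcases this with h | h
    · exact absurd h hε.ne'
    · exact h
  · push Not at hf
    obtain ⟨m, hm, hmy⟩ := lemM hyP
    exact ⟨m, hm, funext fun e => (hmy e (hf e)).symm⟩

lemma PS_convex : Convex ℝ (PS n) := by
  intro x hx y hy a b ha hb hab
  refine ⟨fun e => ?_, fun v I hI => ?_⟩
  · have := hx.1 e; have := hy.1 e
    simp only [Pi.add_apply, Pi.smul_apply, smul_eq_mul]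
    constructor <;> nlinarith
  · have h1 := hx.2 v I hI
    have h2 := hy.2 v I hI
    have : Dd (inc n v) I (a • x + b • y) = a * Dd (inc n v) I x + b * Dd (inc n v) I y := by
      unfold Dd
      rw [Finset.mul_sum, Finset.mul_sum, ← Finset.sum_add_distrib]
      refine Finset.sum_congr rfl fun e _ => ?_
      simp only [tmv, Pi.add_apply, Pi.smul_apply, smul_eq_mul]
      split_ifs
      · linear_combination (-1 : ℝ) * hab
      · ring
    rw [this]; nlinarith

lemma PS_compact : IsCompact (PS n) := by
  have hsub : PS n ⊆ Set.Icc 0 1 := fun y hy => ⟨fun e => (hy.1 e).1, fun e => (hy.1 e).2⟩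
  refine isCompact_Icc.of_isClosed_subset ?_ hsub
  have : PS n = (⋂ e, {y | 0 ≤ y e ∧ y e ≤ 1}) ∩
      ⋂ v, ⋂ I : Fin n × Fin 3 → ZMod 2, ⋂ _ : ∑ e ∈ inc n v, I e = 1, {y | 1 ≤ Dd (inc n v) I y} := by
    ext y
    simp only [PS, PPs, Set.mem_ofPred_eq, Set.mem_inter_iff, Set.mem_iInter]
  rw [this]
  refine IsClosed.inter (isClosed_iInter fun e => ?_)
    (isClosed_iInter fun v => isClosed_iInter fun I => isClosed_iInter fun _ => ?_)
  · exact (isClosed_le continuous_const (continuous_apply e)).inter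
      (isClosed_le (continuous_apply e) continuous_const)
  · refine isClosed_le continuous_const ?_
    unfold Dd
    refine continuous_finsetSum _ fun e _ => ?_
    unfold tmv
    split_ifs <;> fun_prop

theorem PS_subset : PS n ⊆ convexHull ℝ (bits '' EvenSet n) := by
  have hfin : (bits '' EvenSet n).Finite := (Set.toFinite _).image _
  rw [← closure_convexHull_extremePoints PS_compact PS_convex]
  apply closure_minimal
  · exact convexHull_mono fun y hy => ext_int hy
  · exact hfin.isClosed_convexHull (𝕜 := ℝ)
end graph

section final
variable {d n : ℕ}

lemma dot_add (η a b : F2 d) : ∑ j, η j * (a + b) j = ∑ j, η j * a j + ∑ j, η j * b j := by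
  simp [mul_add, Finset.sum_add_distrib]

/-- mass of `η · ω = 1` in block `i`. -/
noncomputable def mass (η : F2 d) (x : Fin n → F2 d → ℝ) (i : Fin n) : ℝ :=
  ∑ ω, if (∑ j, η j * ω j) = 1 then x i ω else 0

lemma los_eq (B : Fin n → Set (F2 d)) (x : Fin n → F2 d → ℝ) (hx : x ∈ TP B) (η : F2 d)
    (I : Finset (Fin n)) :
    losLHS B η I x = ∑ i, if i ∈ I then 1 - mass η x i else mass η x i := by
  have h1 : ∀ i, ∑ ω ∈ Finset.univ.filter (fun ω : F2 d => ω ∈ B i ∧ (∑ j, η j * ω j) = 1), x i ω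
      = mass η x i := by
    intro i
    rw [mass, Finset.sum_filter]
    refine Finset.sum_congr rfl fun ω _ => ?_
    by_cases h : ω ∈ B i
    · simp only [h, true_and]
    · simp [h, hx.2.1 i ω h]
  have h0 : ∀ i, ∑ ω ∈ Finset.univ.filter (fun ω : F2 d => ω ∈ B i ∧ (∑ j, η j * ω j) = 0), x i ω
      = 1 - mass η x i := by
    intro i
    rw [eq_sub_iff_add_eq, ← hx.2.2 i, mass, Finset.sum_filter, ← Finset.sum_add_distrib]
    refine Finset.sum_congr rfl fun ω _ => ?_
    by_cases h : ω ∈ B i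
    · simp only [h, true_and]
      rcases zm2 (∑ j, η j * ω j) with h' | h' <;> simp [h']
    · simp [h, hx.2.1 i ω h]
  unfold losLHS
  simp only [h0, h1]
  rw [← Finset.sum_add_sum_compl I (fun i => if i ∈ I then 1 - mass η x i else mass η x i)]
  congr 1
  · exact Finset.sum_congr rfl fun i hi => by simp [hi]
  · exact Finset.sum_congr rfl fun i hi => by simp [Finset.mem_compl.1 hi]

lemma mass_comb (η : F2 d) (x y : Fin n → F2 d → ℝ) (a b : ℝ) (i : Fin n) :
    mass η (a • x + b • y) i = a * mass η x i + b * mass η y i := by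
  unfold mass
  rw [Finset.mul_sum, Finset.mul_sum, ← Finset.sum_add_distrib]
  refine Finset.sum_congr rfl fun ω _ => ?_
  split_ifs <;> simp

lemma TP_convex (B : Fin n → Set (F2 d)) : Convex ℝ (TP B) := by
  intro x hx y hy a b ha hb hab
  refine ⟨fun i ω => ?_, fun i ω h => ?_, fun i => ?_⟩
  · have := hx.1 i ω; have := hy.1 i ω
    simp only [Pi.add_apply, Pi.smul_apply, smul_eq_mul]; positivity
  · simp [hx.2.1 i ω h, hy.2.1 i ω h]
  · simp only [Pi.add_apply, Pi.smul_apply, smul_eq_mul, Finset.sum_add_distrib, ← Finset.mul_sum,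
      hx.2.2 i, hy.2.2 i]
    linarith

lemma inc_TP (B : Fin n → Set (F2 d)) (ξ : Fin n → F2 d) (h : ∀ i, ξ i ∈ B i) :
    incVec ξ ∈ TP B := by
  refine ⟨fun i ω => ?_, fun i ω hω => ?_, fun i => ?_⟩
  · unfold incVec; split_ifs <;> norm_num
  · have : ξ i ≠ ω := by rintro rfl; exact hω (h i)
    simp [incVec, this]
  · simp [incVec]

lemma mass_inc (η : F2 d) (ξ : Fin n → F2 d) (i : Fin n) :
    mass η (incVec ξ) i = if ∑ j, η j * ξ i j = 1 then 1 else 0 := by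
  unfold mass incVec
  rw [Finset.sum_eq_single (ξ i)]
  · simp
  · intro b _ hb; simp [hb.symm]
  · simp

lemma card_cast (I : Finset (Fin n)) :
    ∑ i, (if i ∈ I then (1 : ZMod 2) else 0) = (I.card : ZMod 2) := by
  simp

lemma odd_cast (k : ℕ) : Odd k ↔ (k : ZMod 2) = 1 := by
  exact (ZMod.natCast_eq_one_iff_odd).symm

lemma easy (B : Fin n → Set (F2 d)) :
    CTP B ⊆ { x ∈ TP B | ∀ (η : F2 d), η ≠ 0 → ∀ I : Finset (Fin n), Odd I.card →
      1 ≤ losLHS B η I x } := by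
  apply convexHull_min
  · rintro _ ⟨ξ, ⟨hB, hs⟩, rfl⟩
    refine ⟨inc_TP B ξ hB, fun η _ I hI => ?_⟩
    rw [los_eq B _ (inc_TP B ξ hB)]
    simp only [mass_inc]
    have nn : ∀ i ∈ (Finset.univ : Finset (Fin n)), (0 : ℝ) ≤ if i ∈ I then
        1 - (if ∑ j, η j * ξ i j = 1 then (1 : ℝ) else 0)
        else (if ∑ j, η j * ξ i j = 1 then 1 else 0) := by
      intro i _
      split_ifs <;> norm_num
    by_cases hall : ∀ i, ∑ j, η j * ξ i j = if i ∈ I then 1 else 0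
    · exfalso
      have h1 : ∑ i, ∑ j, η j * ξ i j = 0 := by
        rw [Finset.sum_comm]
        apply Finset.sum_eq_zero
        intro j _
        rw [← Finset.mul_sum]
        have := congrFun hs j
        rw [Finset.sum_apply] at this
        rw [this]; simp
      rw [Finset.sum_congr rfl (fun i _ => hall i), card_cast, (odd_cast _).1 hI] at h1
      exact one_ne_zero h1
    · push Not at hall
      obtain ⟨i, hi⟩ := hall
      have := Finset.single_le_sum nn (Finset.mem_univ i)
      refine le_trans ?_ this
      rcases zm2 (∑ j, η j * ξ i j) with h | h <;> by_cases hI : i ∈ I <;> simp [h, hI] at hi ⊢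
  · rintro x ⟨hx, hx'⟩ y ⟨hy, hy'⟩ a b ha hb hab
    have hxy := TP_convex B hx hy ha hb hab
    refine ⟨hxy, fun η h0 I hI => ?_⟩
    have h1 := hx' η h0 I hI
    have h2 := hy' η h0 I hI
    have : losLHS B η I (a • x + b • y) = a * losLHS B η I x + b * losLHS B η I y := by
      rw [los_eq B _ hxy, los_eq B _ hx, los_eq B _ hy]
      rw [Finset.mul_sum, Finset.mul_sum, ← Finset.sum_add_distrib]
      refine Finset.sum_congr rfl fun i _ => ?_
      rw [mass_comb]
      split_ifs
      · linear_combination (-1 : ℝ) * hab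
      · ring
    rw [this]; nlinarith

lemma face (B : Fin n → Set (F2 d)) (x : Fin n → F2 d → ℝ)
    (hx : x ∈ convexHull ℝ (incVec '' {ξ : Fin n → F2 d | ∑ i, ξ i = 0}))
    (h0 : ∀ i ω, ω ∉ B i → x i ω = 0) : x ∈ CTP B := by
  let C : Set (Fin n → F2 d → ℝ) :=
    {x | (∀ i ω, 0 ≤ x i ω) ∧ ((∀ i ω, ω ∉ B i → x i ω = 0) → x ∈ CTP B)}
  have : convexHull ℝ (incVec '' {ξ : Fin n → F2 d | ∑ i, ξ i = 0}) ⊆ C := by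
    apply convexHull_min
    · rintro _ ⟨ξ, hξ, rfl⟩
      refine ⟨fun i ω => ?_, fun h => ?_⟩
      · unfold incVec; split_ifs <;> norm_num
      · apply subset_convexHull
        refine ⟨ξ, ⟨fun i => ?_, hξ⟩, rfl⟩
        by_contra hc
        have := h i (ξ i) hc
        simp [incVec] at this
    · rintro p ⟨hp, hp'⟩ q ⟨hq, hq'⟩ a b ha hb hab
      refine ⟨fun i ω => ?_, fun h => ?_⟩
      · have := hp i ω; have := hq i ω
        simp only [Pi.add_apply, Pi.smul_apply, smul_eq_mul]; positivity
      · rcases ha.eq_or_lt with rfl | ha'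
        · have : b = 1 := by linarith
          subst this
          simp only [zero_smul, one_smul, zero_add] at h ⊢
          exact hq' h
        rcases hb.eq_or_lt with rfl | hb'
        · have : a = 1 := by linarith
          subst this
          simp only [zero_smul, one_smul, add_zero] at h ⊢
          exact hp' h
        refine (convex_convexHull ℝ _) (hp' fun i ω hω => ?_) (hq' fun i ω hω => ?_) ha hb hab
        · have h1 := h i ω hω
          simp only [Pi.add_apply, Pi.smul_apply, smul_eq_mul] at h1
          have := hp i ω; have := hq i ω
          by_contra hne
          have : 0 < p i ω := lt_of_le_of_ne (hp i ω) (Ne.symm hne)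
          have : 0 < a * p i ω := by positivity
          have : 0 ≤ b * q i ω := by positivity
          linarith
        · have h1 := h i ω hω
          simp only [Pi.add_apply, Pi.smul_apply, smul_eq_mul] at h1
          have := hp i ω; have := hq i ω
          by_contra hne
          have : 0 < q i ω := lt_of_le_of_ne (hq i ω) (Ne.symm hne)
          have : 0 < b * q i ω := by positivity
          have : 0 ≤ a * p i ω := by positivity
          linarith
  exact (this hx).2 h0

abbrev U2 := Fin 2 → ZMod 2

lemma setup (B : Fin n → Set (F2 d)) (h : blockRank B = 2) :
    ∃ (g : U2 →ₗ[ZMod 2] F2 d) (f : F2 d →ₗ[ZMod 2] U2), (∀ u, f (g u) = u) ∧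
      ∀ i, ∀ ω ∈ B i, ∃ u, g u = ω := by
  let V := Submodule.span (ZMod 2) (⋃ i, B i)
  let b : Module.Basis (Fin 2) (ZMod 2) V := Module.finBasisOfFinrankEq _ _ h
  let g : U2 →ₗ[ZMod 2] F2 d := V.subtype ∘ₗ b.equivFun.symm.toLinearMap
  have hg : LinearMap.ker g = ⊥ := by
    rw [LinearMap.ker_eq_bot]
    exact V.injective_subtype.comp b.equivFun.symm.injective
  obtain ⟨f, hf⟩ := LinearMap.exists_leftInverse_of_injective g hg
  refine ⟨g, f, fun u => congrArg (fun k => k u) hf, fun i ω hω => ?_⟩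
  have hV : ω ∈ V := Submodule.subset_span (Set.mem_iUnion.2 ⟨i, hω⟩)
  exact ⟨b.equivFun ⟨ω, hV⟩, by simp [g]⟩

def pj (k : Fin 2) : U2 →ₗ[ZMod 2] ZMod 2 := LinearMap.proj k

def lam (c : Fin 3) : U2 →ₗ[ZMod 2] ZMod 2 :=
  match c with
  | 0 => pj 0
  | 1 => pj 1
  | 2 => pj 0 + pj 1

lemma lam0 (u : U2) : lam 0 u = u 0 := rfl
lemma lam1 (u : U2) : lam 1 u = u 1 := rfl
lemma lam2 (u : U2) : lam 2 u = u 0 + u 1 := rfl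

lemma dot_of (φ : F2 d →ₗ[ZMod 2] ZMod 2) (ω : F2 d) :
    ∑ j, φ (Pi.single j 1) * ω j = φ ω := by
  conv_rhs => rw [LinearMap.pi_apply_eq_sum_univ φ ω]
  refine Finset.sum_congr rfl fun j _ => ?_
  rw [smul_eq_mul, mul_comm]
  congr 2
  funext k
  simp [Pi.single_apply, eq_comm]

lemma sum4 (g : U2 →ₗ[ZMod 2] F2 d) (hg : Function.Injective g) (h : F2 d → ℝ)
    (h0 : ∀ ω, (∀ u, g u ≠ ω) → h ω = 0) :
    ∑ ω, h ω = h (g ![0, 0]) + h (g ![0, 1]) + h (g ![1, 0]) + h (g ![1, 1]) := by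
  rw [← Fintype.sum_of_injective g hg (fun u => h (g u)) h (fun ω hω => h0 ω (by simpa using hω))
    (fun _ => rfl)]
  have hu : (Finset.univ : Finset U2) = {![0, 0], ![0, 1], ![1, 0], ![1, 1]} := by decide
  rw [hu, Finset.sum_insert (by decide), Finset.sum_insert (by decide),
    Finset.sum_insert (by decide), Finset.sum_singleton]
  ring

lemma u4 : ∀ u : U2, u = ![0, 0] ∨ u = ![0, 1] ∨ u = ![1, 0] ∨ u = ![1, 1] := by decide

/-- the inverse Fourier transform -/
noncomputable def TT (g : U2 →ₗ[ZMod 2] F2 d) (f : F2 d →ₗ[ZMod 2] U2)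
    (y : Fin n × Fin 3 → ℝ) : Fin n → F2 d → ℝ := fun i ω =>
  if ∃ u, g u = ω then
    (1 + ∑ c, (if lam c (f ω) = 1 then -1 else 1) * (1 - 2 * y (i, c))) / 4 else 0

lemma TT_bits (g : U2 →ₗ[ZMod 2] F2 d) (f : F2 d →ₗ[ZMod 2] U2) (hfg : ∀ u, f (g u) = u)
    (m : Fin n × Fin 3 → ZMod 2) (hm : m ∈ EvenSet n) :
    TT g f (bits m) ∈ incVec '' {ξ : Fin n → F2 d | ∑ i, ξ i = 0} := by
  have hinj : Function.Injective g := Function.LeftInverse.injective hfg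
  refine ⟨fun i => g ![m (i, 0), m (i, 1)], ?_, ?_⟩
  · change ∑ i, g ![m (i, 0), m (i, 1)] = 0
    rw [← map_sum]
    have : ∑ i, ![m (i, 0), m (i, 1)] = (0 : U2) := by
      funext k
      rw [Finset.sum_apply]
      fin_cases k
      · have := hm (Sum.inr 0)
        rw [sum_inr] at this
        simpa using this
      · have := hm (Sum.inr 1)
        rw [sum_inr] at this
        simpa using this
    rw [this, map_zero]
  · funext i ω
    unfold incVec TT
    by_cases h : ∃ u, g u = ω
    · rw [if_pos h]
      obtain ⟨u, rfl⟩ := h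
      simp only [hinj.eq_iff]
      rw [hfg, Fin.sum_univ_three, lam0, lam1, lam2]
      have hr := hm (Sum.inl i)
      rw [sum_inl, Fin.sum_univ_three] at hr
      simp only [bits]
      have h2 : m (i, 2) = m (i, 0) + m (i, 1) := by
        generalize m (i, 0) = p at *
        generalize m (i, 1) = q at *
        generalize m (i, 2) = r at *
        clear * - hr
        revert p q r; decide
      rw [h2]
      generalize m (i, 0) = p
      generalize m (i, 1) = q
      have e01 : (1 : ZMod 2) + 1 = 0 := by decide
      rcases u4 u with rfl | rfl | rfl | rfl <;> rcases zm2 p with rfl | rfl <;>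
        rcases zm2 q with rfl | rfl <;> simp [e01] <;> norm_num
    · rw [if_neg h, if_neg]
      intro hh
      exact h ⟨_, hh⟩

lemma hard (B : Fin n → Set (F2 d)) (hrank : blockRank B = 2) (x : Fin n → F2 d → ℝ)
    (hx : x ∈ TP B) (hlos : ∀ (η : F2 d), η ≠ 0 → ∀ I : Finset (Fin n), Odd I.card →
      1 ≤ losLHS B η I x) : x ∈ CTP B := by
  obtain ⟨g, f, hfg, hgB⟩ := setup B hrank
  have hinj : Function.Injective g := Function.LeftInverse.injective hfg
  have hx0 : ∀ i ω, (∀ u, g u ≠ ω) → x i ω = 0 := by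
    intro i ω h
    apply hx.2.1
    intro hB
    obtain ⟨u, hu⟩ := hgB i ω hB
    exact h u hu
  let φ : Fin 3 → F2 d →ₗ[ZMod 2] ZMod 2 := fun c => lam c ∘ₗ f
  let η : Fin 3 → F2 d := fun c j => φ c (Pi.single j 1)
  have hη : ∀ c ω, ∑ j, η c j * ω j = lam c (f ω) := fun c ω => dot_of (φ c) ω
  have hη0 : ∀ c, η c ≠ 0 := by
    intro c h
    have h1 : ∀ u, lam c u = 0 := by
      intro u
      have := hη c (g u)
      rw [h, hfg] at this
      simpa using this.symm
    fin_cases c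
    · exact absurd (h1 ![1, 0]) (by change lam 0 _ ≠ 0; rw [lam0]; decide)
    · exact absurd (h1 ![0, 1]) (by change lam 1 _ ≠ 0; rw [lam1]; decide)
    · exact absurd (h1 ![1, 0]) (by change lam 2 _ ≠ 0; rw [lam2]; decide)
  let y : Fin n × Fin 3 → ℝ := fun e => mass (η e.2) x e.1
  have hsum : ∀ i, x i (g ![0, 0]) + x i (g ![0, 1]) + x i (g ![1, 0]) + x i (g ![1, 1]) = 1 := by
    intro i
    rw [← sum4 g hinj (x i) (hx0 i)]
    exact hx.2.2 i
  have hmass : ∀ i c, y (i, c) = ∑ ω, if lam c (f ω) = 1 then x i ω else 0 := by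
    intro i c
    simp only [y, mass, hη]
  have hmass' : ∀ i c, y (i, c) = (if lam c ![0, 0] = 1 then x i (g ![0, 0]) else 0) +
      (if lam c ![0, 1] = 1 then x i (g ![0, 1]) else 0) +
      (if lam c ![1, 0] = 1 then x i (g ![1, 0]) else 0) +
      (if lam c ![1, 1] = 1 then x i (g ![1, 1]) else 0) := by
    intro i c
    rw [hmass, sum4 g hinj]
    · simp only [hfg]
    · intro ω h
      simp [hx0 i ω h]
  have e01 : (1 : ZMod 2) + 1 = 0 := by decide
  have y0 : ∀ i, y (i, 0) = x i (g ![1, 0]) + x i (g ![1, 1]) := by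
    intro i; rw [hmass']; simp [lam0]
  have y1 : ∀ i, y (i, 1) = x i (g ![0, 1]) + x i (g ![1, 1]) := by
    intro i; rw [hmass']; simp [lam1]
  have y2 : ∀ i, y (i, 2) = x i (g ![0, 1]) + x i (g ![1, 0]) := by
    intro i; rw [hmass']; simp [lam2, e01]
  have hyP : y ∈ PS n := by
    refine ⟨?_, ?_⟩
    · rintro ⟨i, c⟩
      have a1 := hx.1 i (g ![0, 0])
      have a2 := hx.1 i (g ![0, 1])
      have a3 := hx.1 i (g ![1, 0])
      have a4 := hx.1 i (g ![1, 1])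
      have := hsum i
      rw [hmass']
      constructor <;> split_ifs <;> linarith
    · rintro (i | c) I hI
      · unfold Dd
        rw [sum_inl, Fin.sum_univ_three] at hI ⊢
        rw [y0, y1, y2]
        have a1 := hx.1 i (g ![0, 0])
        have a2 := hx.1 i (g ![0, 1])
        have a3 := hx.1 i (g ![1, 0])
        have a4 := hx.1 i (g ![1, 1])
        have hs := hsum i
        generalize I (i, 0) = p at *
        generalize I (i, 1) = q at *
        generalize I (i, 2) = r at *
        rcases zm2 p with rfl | rfl <;> rcases zm2 q with rfl | rfl <;> rcases zm2 r with rfl | rfl <;>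
          first
          | (exfalso; clear * - hI; revert hI; decide)
          | (simp only [tmv, zero_ne_one, if_true, if_false]; linarith)
      · unfold Dd
        rw [sum_inr] at hI ⊢
        have hodd : Odd (Finset.univ.filter (fun i => I (i, c) = 1)).card := by
          rw [odd_cast, ← card_cast]
          refine Eq.trans ?_ hI
          refine Finset.sum_congr rfl fun i _ => ?_
          rcases zm2 (I (i, c)) with h | h <;> simp [h]
        have := hlos (η c) (hη0 c) _ hodd
        rw [los_eq B x hx] at this
        refine this.trans (le_of_eq ?_)
        refine Finset.sum_congr rfl fun i _ => ?_
        simp [tmv, y]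
  have hTy : TT g f y = x := by
    funext i ω
    unfold TT
    by_cases h : ∃ u, g u = ω
    · rw [if_pos h]
      obtain ⟨u, rfl⟩ := h
      have hs := hsum i
      rw [hfg, Fin.sum_univ_three, lam0, lam1, lam2, y0, y1, y2]
      rcases u4 u with rfl | rfl | rfl | rfl <;> simp [e01] <;> linarith
    · rw [if_neg h, hx0 i ω (by simpa using h)]
  apply face B x _ hx.2.1
  rw [← hTy]
  have hsub : convexHull ℝ (bits '' EvenSet n) ⊆
      {y | TT g f y ∈ convexHull ℝ (incVec '' {ξ : Fin n → F2 d | ∑ i, ξ i = 0})} := by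
    apply convexHull_min
    · rintro _ ⟨m, hm, rfl⟩
      exact subset_convexHull ℝ _ (TT_bits g f hfg m hm)
    · intro p hp q hq a b ha hb hab
      have : TT g f (a • p + b • q) = a • TT g f p + b • TT g f q := by
        funext i ω
        simp only [TT, Pi.add_apply, Pi.smul_apply, smul_eq_mul, Fin.sum_univ_three]
        by_cases h : ∃ u, g u = ω
        · simp only [if_pos h]
          have hb' : b = 1 - a := by linarith
          subst hb'
          ring
        · simp only [if_neg h]; ring
      rw [Set.mem_ofPred_eq] at hp hq ⊢
      rw [this]
      exact convex_convexHull ℝ _ hp hq ha hb hab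
  exact hsub (PS_subset hyP)
end final

/-- CTPs of rank-2 block configurations are described by the LOS
inequalities within the transversal polytope. -/
theorem statement13 (d n : ℕ) (hn : 2 ≤ n) (B : Fin n → Set (F2 d))
    (hB : ∀ i, (B i).Nonempty) (hrank : blockRank B = 2) :
    CTP B = { x ∈ TP B | ∀ (η : F2 d), η ≠ 0 → ∀ I : Finset (Fin n), Odd I.card →
      1 ≤ losLHS B η I x } :=
  Set.Subset.antisymm (easy B) fun x hx => hard B hrank x hx.1 hx.2
end

section
/- For every block configuration B in 𝔽₂^d, the rank-2 relaxation of the cyclic transversal polytope coincides with the rank-1 relaxation: RP[B][2] = RP[B][1]. -/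
open scoped Classical

/-- The `φ`-induced map `Φ` (w.r.t. the block configuration `B`):
`Φ(x)^i_{ω'} = Σ_{ω ∈ B(i), φ(ω) = ω'} x^i_ω`. -/
noncomputable def indMap {d d' n : ℕ} (B : Fin n → Set (F2 d)) (φ : F2 d →ₗ[ZMod 2] F2 d')
    (x : Fin n → F2 d → ℝ) : Fin n → F2 d' → ℝ :=
  fun i ω' => ∑ ω ∈ Finset.univ.filter (fun ω : F2 d => ω ∈ B i ∧ φ ω = ω'), x i ω

/-- The `φ`-relaxation `RP[B][φ]` of `CTP[B]`. -/
noncomputable def RP {d d' n : ℕ} (B : Fin n → Set (F2 d)) (φ : F2 d →ₗ[ZMod 2] F2 d') :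
    Set (Fin n → F2 d → ℝ) :=
  { x ∈ TP B | indMap B φ x ∈ CTP (fun i => φ '' B i) }

/-- The rank-`r` relaxation `RP[B][r]` of `CTP[B]`: the intersection of the `φ`-relaxations
over all linear maps `φ` with domain `𝔽₂^d` whose image has dimension at most `r`. -/
noncomputable def RPr {d n : ℕ} (B : Fin n → Set (F2 d)) (r : ℕ) :
    Set (Fin n → F2 d → ℝ) :=
  ⋂ (d' : ℕ), ⋂ (φ : F2 d →ₗ[ZMod 2] F2 d'),
    ⋂ (_ : Module.finrank (ZMod 2) (LinearMap.range φ) ≤ r), RP B φ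

set_option linter.unusedSectionVars false

namespace CT

abbrev K : Type := ZMod 2 × ZMod 2

def ef (k : Fin 3) (p : K) : ZMod 2 := ![p.1, p.2, p.1 + p.2] k

def g (k : Fin 3) : K := ![(0, 1), (1, 0), (1, 1)] k

lemma ef_add (k : Fin 3) (p q : K) : ef k (p + q) = ef k p + ef k q := by
  revert k p q; decide

lemma ef_zero (k : Fin 3) : ef k 0 = 0 := by revert k; decide

lemma ef_smul (k : Fin 3) (c : ZMod 2) (p : K) : ef k (c • p) = c • ef k p := by
  revert k c p; decide

def eL (k : Fin 3) : K →ₗ[ZMod 2] ZMod 2 where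
  toFun := ef k
  map_add' := ef_add k
  map_smul' := ef_smul k

lemma ef_sum {ι : Type*} (s : Finset ι) (k : Fin 3) (f : ι → K) :
    ef k (∑ i ∈ s, f i) = ∑ i ∈ s, ef k (f i) := map_sum (eL k) f s

lemma z2 (a b : ZMod 2) (h : a ≠ b) : a = b + 1 := by revert a b; decide

noncomputable def r (k : Fin 3) (a : ZMod 2) (f : K → ℝ) : ℝ := ∑ ω, if ef k ω = a then 0 else f ω

lemma r_nonneg {k a} {f : K → ℝ} (hf : ∀ ω, 0 ≤ f ω) : 0 ≤ r k a f :=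
  Finset.sum_nonneg fun ω _ => by split_ifs <;> simp [hf]

lemma r_add (k a) (f h : K → ℝ) : r k a (f + h) = r k a f + r k a h := by
  unfold r; rw [← Finset.sum_add_distrib]; refine Finset.sum_congr rfl fun ω _ => ?_
  split_ifs <;> simp

lemma r_smul (k a) (c : ℝ) (f : K → ℝ) : r k a (c • f) = c * r k a f := by
  unfold r; rw [Finset.mul_sum]; refine Finset.sum_congr rfl fun ω _ => ?_
  split_ifs <;> simp

lemma r_compl (k a) (f : K → ℝ) : r k a f + r k (a + 1) f = ∑ ω, f ω := by
  unfold r; rw [← Finset.sum_add_distrib]; refine Finset.sum_congr rfl fun ω _ => ?_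
  have : ∀ x a : ZMod 2, (x = a ∧ ¬ x = a + 1) ∨ (¬ x = a ∧ x = a + 1) := by decide
  rcases this (ef k ω) a with ⟨h1, h2⟩ | ⟨h1, h2⟩
  · rw [if_pos h1, if_neg h2, zero_add]
  · rw [if_neg h1, if_pos h2, add_zero]

lemma r_eq_zero {k a} {f : K → ℝ} (hf : ∀ ω, 0 ≤ f ω) :
    r k a f = 0 ↔ ∀ ω, f ω ≠ 0 → ef k ω = a := by
  unfold r
  rw [Finset.sum_eq_zero_iff_of_nonneg]
  · constructor
    · intro h ω hω
      by_contra hc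
      have := h ω (Finset.mem_univ _)
      rw [if_neg hc] at this
      exact hω this
    · intro h ω _
      split_ifs with hc
      · rfl
      · by_contra h0; exact hc (h ω h0)
  · intro ω _; split_ifs <;> simp [hf]

variable {ι : Type} [Fintype ι] 

noncomputable def inc (ξ : ι → K) : ι → K → ℝ := fun i ω => if ξ i = ω then 1 else 0

lemma r_inc (k a) (ξ : ι → K) (i : ι) : r k a (inc ξ i) = if ef k (ξ i) = a then 0 else 1 := by
  unfold r inc
  rw [Finset.sum_eq_single (ξ i)]
  · simp
  · intro b _ hb; rw [if_neg (Ne.symm hb)]; simp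
  · simp

lemma sum_inc (ξ : ι → K) (i : ι) : ∑ ω, inc ξ i ω = 1 := by
  unfold inc; simp

def Q (ι : Type) [Fintype ι] : Set (ι → K → ℝ) :=
  {y | (∀ i ω, 0 ≤ y i ω) ∧ (∀ i, ∑ ω, y i ω = 1) ∧
    ∀ (k : Fin 3) (I : ι → ZMod 2), ∑ i, I i = 1 → 1 ≤ ∑ i, r k (I i) (y i)}

lemma Q_convex : Convex ℝ (Q ι) := by
  intro x hx y hy a b ha hb hab
  refine ⟨fun i ω => ?_, fun i => ?_, fun k I hI => ?_⟩
  · have := hx.1 i ω; have := hy.1 i ω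
    simp only [Pi.add_apply, Pi.smul_apply, smul_eq_mul]; positivity
  · simp only [Pi.add_apply, Pi.smul_apply, smul_eq_mul]
    rw [Finset.sum_add_distrib, ← Finset.mul_sum, ← Finset.mul_sum, hx.2.1, hy.2.1]; linarith
  · have h1 := hx.2.2 k I hI
    have h2 := hy.2.2 k I hI
    have : ∑ i, r k (I i) ((a • x + b • y) i) = a * ∑ i, r k (I i) (x i) + b * ∑ i, r k (I i) (y i) := by
      rw [Finset.mul_sum, Finset.mul_sum, ← Finset.sum_add_distrib]
      refine Finset.sum_congr rfl fun i _ => ?_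
      rw [Pi.add_apply, Pi.smul_apply, Pi.smul_apply, r_add, r_smul, r_smul]
    rw [this]; nlinarith

lemma r_cont (k a) (i : ι) : Continuous fun y : ι → K → ℝ => r k a (y i) := by
  unfold r
  refine continuous_finsetSum _ fun ω _ => ?_
  split_ifs <;> fun_prop

lemma Q_compact : IsCompact (Q ι) := by
  have hsub : Q ι ⊆ Set.Icc (0 : ι → K → ℝ) 1 := by
    intro y hy
    refine ⟨fun i ω => hy.1 i ω, fun i ω => ?_⟩
    have := Finset.single_le_sum (f := y i) (fun ω _ => hy.1 i ω) (Finset.mem_univ ω)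
    rw [hy.2.1 i] at this; exact this
  refine IsCompact.of_isClosed_subset isCompact_Icc ?_ hsub
  unfold Q
  simp only [Set.ofPred_and, Set.ofPred_forall]
  refine IsClosed.inter ?_ (IsClosed.inter ?_ ?_)
  · exact isClosed_iInter fun i => isClosed_iInter fun ω => isClosed_le (by fun_prop) (by fun_prop)
  · exact isClosed_iInter fun i => isClosed_eq (by fun_prop) (by fun_prop)
  · exact isClosed_iInter fun k => isClosed_iInter fun I => isClosed_iInter fun _ =>
      isClosed_le (by fun_prop) (continuous_finsetSum _ fun i _ => r_cont k (I i) i)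

/-- number of violations -/
lemma cast_count (k : Fin 3) (I : ι → ZMod 2) (ξ : ι → K) :
    ∑ i, r k (I i) (inc ξ i) = ((Finset.univ.filter fun i => ef k (ξ i) ≠ I i).card : ℝ) := by
  rw [Finset.card_filter]; push_cast
  refine Finset.sum_congr rfl fun i _ => ?_
  rw [r_inc]; by_cases h : ef k (ξ i) = I i <;> simp [h]

lemma count_odd (k : Fin 3) (I : ι → ZMod 2) (hI : ∑ i, I i = 1) (ξ : ι → K) (hξ : ∑ i, ξ i = 0) :
    Odd (Finset.univ.filter fun i => ef k (ξ i) ≠ I i).card := by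
  rw [← ZMod.natCast_eq_one_iff_odd, Finset.card_filter]
  push_cast
  have : ∀ a b : ZMod 2, (if a ≠ b then (1 : ZMod 2) else 0) = a + b := by decide
  have h2 : ∑ i, (ef k (ξ i) + I i) = 1 := by
    rw [Finset.sum_add_distrib, ← ef_sum, hξ, ef_zero, hI, zero_add]
  rw [← h2]
  refine Finset.sum_congr rfl fun i _ => ?_
  rw [← this]; congr

def Tight (y : ι → K → ℝ) (k : Fin 3) (I : ι → ZMod 2) : Prop :=
  ∑ i, I i = 1 ∧ ∑ i, r k (I i) (y i) = 1

/-- directions -/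
def Dir (y v : ι → K → ℝ) : Prop := (∀ i ω, y i ω = 0 → v i ω = 0) ∧ ∀ i, ∑ ω, v i ω = 0

lemma extreme_dir {y v : ι → K → ℝ} (hy : y ∈ (Q ι).extremePoints ℝ) (hv : Dir y v)
    (ht : ∀ k I, Tight y k I → ∑ i, r k (I i) (v i) = 0) : v = 0 := by
  obtain ⟨hyQ, hext⟩ := hy
  have hlin : ∀ (k : Fin 3) (I : ι → ZMod 2) (ε : ℝ), ∑ i, r k (I i) ((y + ε • v) i)
      = ∑ i, r k (I i) (y i) + ε * ∑ i, r k (I i) (v i) := by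
    intro k I ε
    rw [Finset.mul_sum, ← Finset.sum_add_distrib]
    refine Finset.sum_congr rfl fun i _ => ?_
    rw [Pi.add_apply, Pi.smul_apply, r_add, r_smul]
  have key : ∀ᶠ ε in nhds (0 : ℝ), y + ε • v ∈ Q ι := by
    have h1 : ∀ᶠ ε in nhds (0 : ℝ), ∀ i ω, 0 ≤ y i ω + ε * v i ω := by
      rw [Filter.eventually_all]; intro i
      rw [Filter.eventually_all]; intro ω
      by_cases h0 : y i ω = 0
      · simp [h0, hv.1 i ω h0]
      · have hpos : 0 < y i ω := lt_of_le_of_ne (hyQ.1 i ω) (Ne.symm h0)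
        have hc : ContinuousAt (fun ε : ℝ => y i ω + ε * v i ω) 0 := by fun_prop
        have := hc.eventually (lt_mem_nhds (a := 0) (by simpa using hpos))
        exact this.mono fun _ h => le_of_lt h
    have h2 : ∀ᶠ ε in nhds (0 : ℝ), ∀ (k : Fin 3) (I : ι → ZMod 2), ∑ i, I i = 1 →
        1 ≤ ∑ i, r k (I i) (y i) + ε * ∑ i, r k (I i) (v i) := by
      rw [Filter.eventually_all]; intro k
      rw [Filter.eventually_all]; intro I
      by_cases hI : ∑ i, I i = 1
      · by_cases h0 : ∑ i, r k (I i) (y i) = 1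
        · simp [h0, ht k I ⟨hI, h0⟩]
        · have hpos : 1 < ∑ i, r k (I i) (y i) := lt_of_le_of_ne (hyQ.2.2 k I hI) (Ne.symm h0)
          have hc : ContinuousAt (fun ε : ℝ => ∑ i, r k (I i) (y i) + ε * ∑ i, r k (I i) (v i)) 0 := by
            fun_prop
          have := hc.eventually (lt_mem_nhds (a := 1) (by simpa using hpos))
          exact this.mono fun _ h _ => le_of_lt h
      · simp [hI]
    filter_upwards [h1, h2] with ε h1 h2
    refine ⟨h1, fun i => ?_, fun k I hI => ?_⟩
    · simp only [Pi.add_apply, Pi.smul_apply, smul_eq_mul]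
      rw [Finset.sum_add_distrib, ← Finset.mul_sum, hv.2, hyQ.2.1]; simp
    · rw [hlin]; exact h2 k I hI
  have key2 : ∀ᶠ ε in nhds (0 : ℝ), y + (-ε) • v ∈ Q ι := by
    have : Filter.Tendsto (fun ε : ℝ => -ε) (nhds 0) (nhds 0) := by
      simpa using (continuous_neg (G := ℝ)).tendsto 0
    exact this.eventually key
  obtain ⟨ε, ⟨h1, h2⟩, hε⟩ := ((Filter.Eventually.filter_mono nhdsWithin_le_nhds
    (key.and key2)).and (self_mem_nhdsWithin (s := Set.Ioi (0 : ℝ)))).exists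
  have := hext h1 h2 ⟨1/2, 1/2, by norm_num, by norm_num, by norm_num, by
    ext i ω; simp; ring⟩
  have h3 : ε • v = 0 := by simpa using this
  exact (smul_eq_zero.mp h3).resolve_left (ne_of_gt hε)

lemma tight_transfer {y v : ι → K → ℝ} (hy : y ∈ Q ι) (hv : Dir y v) {k : Fin 3} {I I' : ι → ZMod 2}
    (hI : Tight y k I) (hI' : Tight y k I') (h0 : ∑ i, r k (I i) (v i) = 0) :
    ∑ i, r k (I' i) (v i) = 0 := by
  by_cases hII : I = I'
  · rw [← hII]; exact h0
  set D := Finset.univ.filter fun i => I i ≠ I' i with hD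
  have hDne : D.Nonempty := by
    by_contra h
    rw [Finset.not_nonempty_iff_eq_empty, Finset.filter_eq_empty_iff] at h
    exact hII (funext fun i => not_not.mp (h (Finset.mem_univ i)))
  have hDeven : Even D.card := by
    rw [← ZMod.natCast_eq_zero_iff_even, hD, Finset.card_filter]
    push_cast
    have h1 : ∀ a b : ZMod 2, (if a ≠ b then (1 : ZMod 2) else 0) = a + b := by decide
    have h2 : ∑ i, (I i + I' i) = 0 := by
      rw [Finset.sum_add_distrib, hI.1, hI'.1]; decide
    rw [← h2]
    refine Finset.sum_congr rfl fun i _ => ?_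
    rw [← h1]; congr
  have hD2 : 2 ≤ D.card := by
    have := hDne.card_pos
    obtain ⟨m, hm⟩ := hDeven; omega
  have hsum : ∑ i, (r k (I i) (y i) + r k (I' i) (y i)) = 2 := by
    rw [Finset.sum_add_distrib, hI.2, hI'.2]; norm_num
  rw [← Finset.sum_add_sum_compl D] at hsum
  have hDs : ∑ i ∈ D, (r k (I i) (y i) + r k (I' i) (y i)) = D.card := by
    rw [Finset.card_eq_sum_ones]; push_cast
    refine Finset.sum_congr rfl fun i hi => ?_
    have : I' i = I i + 1 := z2 _ _ (Ne.symm (Finset.mem_filter.mp hi).2)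
    rw [this, r_compl, hy.2.1]
  have hnn : ∀ i ∈ Dᶜ, 0 ≤ r k (I i) (y i) + r k (I' i) (y i) := fun i _ =>
    add_nonneg (r_nonneg (hy.1 i)) (r_nonneg (hy.1 i))
  have hz : ∑ i ∈ Dᶜ, (r k (I i) (y i) + r k (I' i) (y i)) = 0 := by
    have h1 := Finset.sum_nonneg hnn
    have h2 : (2 : ℝ) ≤ D.card := by exact_mod_cast hD2
    linarith
  rw [Finset.sum_eq_zero_iff_of_nonneg hnn] at hz
  have : ∑ i, r k (I' i) (v i) = - ∑ i, r k (I i) (v i) := by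
    rw [← Finset.sum_neg_distrib]
    refine Finset.sum_congr rfl fun i _ => ?_
    by_cases hi : i ∈ D
    · have h1 : I' i = I i + 1 := z2 _ _ (Ne.symm (Finset.mem_filter.mp hi).2)
      have h2 := r_compl k (I i) (v i)
      rw [hv.2] at h2
      rw [h1]; linarith
    · have h3 := hz i (Finset.mem_compl.mpr hi)
      have h4 : I i = I' i := by simpa [hD] using hi
      have h5 : r k (I i) (y i) = 0 := by
        have := r_nonneg (k := k) (a := I i) (hy.1 i)
        rw [← h4] at h3; linarith
      rw [r_eq_zero (hy.1 i)] at h5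
      have h6 : r k (I i) (v i) = 0 := by
        unfold r
        refine Finset.sum_eq_zero fun ω _ => ?_
        split_ifs with hc
        · rfl
        · exact hv.1 i ω (by by_contra hne; exact hc (h5 ω hne))
      rw [← h4, h6]; simp
  rw [this, h0, neg_zero]

lemma extreme_dir' {y v : ι → K → ℝ} (hy : y ∈ (Q ι).extremePoints ℝ) (hv : Dir y v)
    (ht : ∀ k, (∃ I, Tight y k I) → ∃ I, Tight y k I ∧ ∑ i, r k (I i) (v i) = 0) : v = 0 := by
  refine extreme_dir hy hv fun k I hI => ?_
  obtain ⟨I', h1, h2⟩ := ht k ⟨I, hI⟩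
  exact tight_transfer hy.1 hv h1 hI h2

/-- an extreme point with a cyclic transversal in its minimal face. -/
lemma extreme_eq_inc {y : ι → K → ℝ} (hy : y ∈ (Q ι).extremePoints ℝ) (ξ : ι → K)
    (hs : ∀ i, y i (ξ i) ≠ 0)
    (ht : ∀ k, (∃ I, Tight y k I) → ∃ I, Tight y k I ∧
      (Finset.univ.filter fun i => ef k (ξ i) ≠ I i).card = 1) : y = inc ξ := by
  have h := extreme_dir' (v := y + (-1 : ℝ) • inc ξ) hy ⟨fun i ω h0 => ?_, fun i => ?_⟩ fun k hk => ?_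
  · rw [neg_one_smul, ← sub_eq_add_neg, sub_eq_zero] at h; exact h
  · have : ξ i ≠ ω := by rintro rfl; exact hs i h0
    simp [inc, h0, this]
  · simp only [Pi.add_apply, Pi.smul_apply, smul_eq_mul]
    rw [Finset.sum_add_distrib, ← Finset.mul_sum, sum_inc, hy.1.2.1]; simp
  · obtain ⟨I, hI, hc⟩ := ht k hk
    refine ⟨I, hI, ?_⟩
    have h1 := cast_count k I ξ
    rw [hc] at h1
    have : ∑ i, r k (I i) ((y + (-1 : ℝ) • inc ξ) i) =
        ∑ i, r k (I i) (y i) + (-1) * ∑ i, r k (I i) (inc ξ i) := by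
      rw [Finset.mul_sum, ← Finset.sum_add_distrib]
      refine Finset.sum_congr rfl fun i _ => ?_
      rw [Pi.add_apply, Pi.smul_apply, r_add, r_smul]
    rw [this, h1, hI.2]; simp

lemma ef_g (k l : Fin 3) : ef k (g l) = if k = l then 0 else 1 := by revert k l; decide

lemma K_sum (F : K → ℝ) : ∑ ω, F ω = F 0 + F (g 0) + F (g 1) + F (g 2) := by
  have : (Finset.univ : Finset K) = {0, g 0, g 1, g 2} := by decide
  rw [this, Finset.sum_insert (by decide), Finset.sum_insert (by decide),
    Finset.sum_insert (by decide), Finset.sum_singleton]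
  ring

lemma r_zero' (k : Fin 3) (f : K → ℝ) : r k 0 f = ∑ ω, f ω - f 0 - f (g k) := by
  unfold r; rw [K_sum, K_sum]
  fin_cases k <;> simp [ef_g, ef_zero] <;> ring

lemma r_one' (k : Fin 3) (f : K → ℝ) : r k 1 f = f 0 + f (g k) := by
  unfold r; rw [K_sum]
  fin_cases k <;> simp [ef_g, ef_zero]

lemma g_sum : ∑ k, g k = 0 := by decide

lemma zmod_cases (a : ZMod 2) (h : a ≠ 1) : a = 0 := by revert a; decide

lemma sum_card_odd (J : ι → ZMod 2) (hJ : ∑ i, J i = 1) :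
    Odd (Finset.univ.filter fun i => J i = 1).card := by
  rw [← ZMod.natCast_eq_one_iff_odd, Finset.card_filter]
  push_cast
  have : ∀ a : ZMod 2, (if a = 1 then (1 : ZMod 2) else 0) = a := by decide
  refine Eq.trans (Finset.sum_congr rfl fun i _ => ?_) hJ
  convert this (J i)

lemma core (z : ι → K → ℝ) (hz : ∀ i ω, 0 ≤ z i ω) (hs : ∀ i, ∑ ω, z i ω = 1)
    (J : ι → ZMod 2) (hJ : ∑ i, J i = 1) (ht : ∀ k, ∑ i, r k (J i) (z i) = 1) :
    ∃ ζ : ι → K, ∑ i, ζ i = 0 ∧ (∀ i, z i (ζ i) ≠ 0) ∧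
      ∀ k, (Finset.univ.filter fun i => ef k (ζ i) ≠ J i).card = 1 := by
  set S := Finset.univ.filter fun i => J i = 1 with hS
  have hodd : Odd S.card := sum_card_odd J hJ
  have memS : ∀ i, i ∈ S ↔ J i = 1 := fun i => by simp [hS]
  have rowz : ∀ i, z i 0 + z i (g 0) + z i (g 1) + z i (g 2) = 1 := fun i => by
    rw [← K_sum, hs]
  have rowle : ∀ i k, z i 0 + z i (g k) ≤ 1 := by
    intro i k
    have := rowz i; have := hz i (g 0); have := hz i (g 1); have := hz i (g 2)
    fin_cases k <;> simp <;> linarith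
  set w : ι → ℝ := fun i => if J i = 1 then z i 0 else 1 - z i 0 with hw
  have hw0 : ∀ i, 0 ≤ w i := by
    intro i; simp only [hw]
    split_ifs
    · exact hz i 0
    · have := rowle i 0; have := hz i (g 0); linarith
  have hr : ∀ k i, r k (J i) (z i) = w i + (if J i = 1 then z i (g k) else - z i (g k)) := by
    intro k i
    simp only [hw]
    by_cases h : J i = 1
    · rw [if_pos h, if_pos h, h, r_one']
    · rw [if_neg h, if_neg h, zmod_cases _ h, r_zero', hs]; ring
  have hk : ∀ k, ∑ i, w i + ∑ i, (if J i = 1 then z i (g k) else - z i (g k)) = 1 := by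
    intro k
    rw [← Finset.sum_add_distrib, ← ht k]
    exact Finset.sum_congr rfl fun i _ => (hr k i).symm
  have htot : (S.card : ℝ) + 2 * ∑ i, w i = 3 := by
    have h1 : ∑ i, ∑ k, r k (J i) (z i) = 3 := by
      rw [Finset.sum_comm]; simp [ht]
    rw [← h1, hS, Finset.card_filter, Finset.mul_sum]; push_cast
    rw [← Finset.sum_add_distrib]
    refine Finset.sum_congr rfl fun i _ => ?_
    rw [Fin.sum_univ_three, hr, hr, hr]
    have := rowz i
    simp only [hw]
    split_ifs <;> linarith
  have hwn : 0 ≤ ∑ i, w i := Finset.sum_nonneg fun i _ => hw0 i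
  have hle3 : S.card ≤ 3 := by
    have : (S.card : ℝ) ≤ 3 := by linarith
    exact_mod_cast this
  have h13 : S.card = 1 ∨ S.card = 3 := by
    obtain ⟨m, hm⟩ := hodd; omega
  rcases h13 with h1 | h3
  · -- a single odd row
    have hw1 : ∑ i, w i = 1 := by rw [h1] at htot; push_cast at htot; linarith
    obtain ⟨j, hj⟩ := Finset.card_eq_one.mp h1
    have hJj : ∀ i, J i = 1 ↔ i = j := fun i => by rw [← memS, hj, Finset.mem_singleton]
    have hJj1 : J j = 1 := (hJj j).2 rfl
    have hJ0 : ∀ i, i ≠ j → J i = 0 := fun i hi => zmod_cases _ (fun h => hi ((hJj i).1 h))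
    have hwj : w j = z j 0 := by simp [hw, hJj1]
    have hwi : ∀ i, i ≠ j → w i = 1 - z i 0 := fun i hi => by simp [hw, hJ0 i hi]
    by_cases h0 : z j 0 = 0
    · have hex : ∃ k, z j (g k) ≠ 0 := by
        by_contra hc; push Not at hc
        have := rowz j; rw [h0, hc, hc, hc] at this; norm_num at this
      obtain ⟨k, hkne⟩ := hex
      have hkk := hk k
      rw [hw1] at hkk
      have hex2 : ∃ i, i ≠ j ∧ z i (g k) ≠ 0 := by
        by_contra hc; push Not at hc
        rw [Finset.sum_eq_single j] at hkk
        · rw [if_pos hJj1] at hkk; exact hkne (by linarith)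
        · intro b _ hb; simp [hc b hb]
        · simp
      obtain ⟨i1, hi1, hi1z⟩ := hex2
      refine ⟨fun i => if i = j ∨ i = i1 then g k else 0, ?_, ?_, ?_⟩
      · rw [← Finset.sum_filter]
        have : (Finset.univ.filter fun i => i = j ∨ i = i1) = {j, i1} := by ext; simp
        rw [this, Finset.sum_pair (Ne.symm hi1)]
        clear * -
        revert k; decide
      · intro i
        by_cases hi : i = j ∨ i = i1
        · simp only [if_pos hi]
          rcases hi with rfl | rfl <;> assumption
        · simp only [if_neg hi]
          push Not at hi
          intro hzi
          have h2 : w i + w i1 ≤ ∑ i, w i := by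
            rw [← Finset.sum_pair hi.2]
            exact Finset.sum_le_sum_of_subset_of_nonneg (Finset.subset_univ _) fun i _ _ => hw0 i
          rw [hwi i hi.1, hwi i1 hi1, hw1, hzi] at h2
          have h3 := rowle i1 k
          have h4 := lt_of_le_of_ne (hz i1 (g k)) (Ne.symm hi1z)
          linarith
      · intro k'
        rw [Finset.card_eq_one]
        by_cases hkk' : k' = k
        · refine ⟨j, ?_⟩
          ext i
          simp only [Finset.mem_filter, Finset.mem_univ, true_and, Finset.mem_singleton]
          by_cases hij : i = j
          · simp [hij, hJj1, ef_g, hkk']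
          · rw [hJ0 i hij]
            by_cases hi : i = i1
            · simp [hi, ef_g, hkk', hi1]
            · simp [hij, hi, ef_zero]
        · refine ⟨i1, ?_⟩
          ext i
          simp only [Finset.mem_filter, Finset.mem_univ, true_and, Finset.mem_singleton]
          by_cases hij : i = j
          · simp [hij, hJj1, ef_g, hkk', Ne.symm hi1]
          · rw [hJ0 i hij]
            by_cases hi : i = i1
            · simp [hi, ef_g, hkk']
            · simp [hij, hi, ef_zero]
    · refine ⟨fun _ => 0, by simp, ?_, ?_⟩
      · intro i
        by_cases hij : i = j
        · rw [hij]; exact h0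
        · intro hzi
          have h2 : w i + w j ≤ ∑ i, w i := by
            rw [← Finset.sum_pair hij]
            exact Finset.sum_le_sum_of_subset_of_nonneg (Finset.subset_univ _) fun i _ _ => hw0 i
          rw [hwi i hij, hwj, hw1, hzi] at h2
          have h4 := lt_of_le_of_ne (hz j 0) (Ne.symm h0)
          linarith
      · intro k
        rw [Finset.card_eq_one]
        refine ⟨j, ?_⟩
        ext i
        simp only [Finset.mem_filter, Finset.mem_univ, true_and, Finset.mem_singleton, ef_zero]
        by_cases hij : i = j
        · simp [hij, hJj1]
        · simp [hij, hJ0 i hij]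
  · -- three odd rows
    have hws : ∑ i, w i = 0 := by rw [h3] at htot; push_cast at htot; linarith
    have hw00 : ∀ i, w i = 0 := fun i =>
      (Finset.sum_eq_zero_iff_of_nonneg fun i _ => hw0 i).mp hws i (Finset.mem_univ i)
    have hout : ∀ i, J i ≠ 1 → z i 0 = 1 := by
      intro i hi; have := hw00 i; simp only [hw, if_neg hi] at this; linarith
    have houtg : ∀ i k, J i ≠ 1 → z i (g k) = 0 := by
      intro i k hi; have := hout i hi; have := rowle i k; have := hz i (g k); linarith
    have hcol : ∀ k, ∑ i, z i (g k) = 1 := by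
      intro k
      rw [← hk k, hws, zero_add]
      refine Finset.sum_congr rfl fun i _ => ?_
      split_ifs with h
      · rfl
      · rw [houtg i k h]; simp
    let t : Fin 3 → Finset ι := fun k => Finset.univ.filter fun i => z i (g k) ≠ 0
    have hall : ∀ s : Finset (Fin 3), s.card ≤ (s.biUnion t).card := by
      intro s
      have h1 : (s.card : ℝ) = ∑ k ∈ s, ∑ i ∈ s.biUnion t, z i (g k) := by
        rw [Finset.card_eq_sum_ones]; push_cast
        refine Finset.sum_congr rfl fun k hks => ?_
        rw [← hcol k]; symm
        refine Finset.sum_subset (Finset.subset_univ _) fun i _ hi => ?_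
        by_contra hc
        exact hi (Finset.mem_biUnion.mpr ⟨k, hks, by simp [t, hc]⟩)
      have h2 : ∑ k ∈ s, ∑ i ∈ s.biUnion t, z i (g k) ≤ ((s.biUnion t).card : ℝ) := by
        rw [Finset.sum_comm, Finset.card_eq_sum_ones]; push_cast
        refine Finset.sum_le_sum fun i _ => ?_
        calc ∑ k ∈ s, z i (g k) ≤ ∑ k, z i (g k) :=
              Finset.sum_le_sum_of_subset_of_nonneg (Finset.subset_univ _) fun k _ _ => hz _ _
          _ ≤ 1 := by
              rw [Fin.sum_univ_three]; have := rowz i; have := hz i 0; linarith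
      rw [← h1] at h2; exact_mod_cast h2
    obtain ⟨f, hf, hft⟩ := (Finset.all_card_le_biUnion_card_iff_exists_injective t).mp hall
    have hfz : ∀ k, z (f k) (g k) ≠ 0 := fun k => by simpa [t] using hft k
    have hfS : ∀ k, J (f k) = 1 := fun k => by
      by_contra hc; exact hfz k (houtg _ k hc)
    have himg : Finset.univ.image f = S := by
      refine Finset.eq_of_subset_of_card_le ?_ ?_
      · intro i hi
        obtain ⟨k, _, rfl⟩ := Finset.mem_image.mp hi
        exact (memS _).2 (hfS k)
      · rw [Finset.card_image_of_injective _ hf, h3]; simp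
    have hsurj : ∀ i, J i = 1 → ∃ k, f k = i := by
      intro i hi
      have := (memS i).2 hi
      rw [← himg] at this
      obtain ⟨k, _, h⟩ := Finset.mem_image.mp this
      exact ⟨k, h⟩
    have hζf : ∀ k, (∑ l, if f k = f l then g l else 0) = g k := by
      intro k
      rw [Finset.sum_eq_single k]
      · simp
      · intro b _ hb; rw [if_neg fun h => hb (hf h).symm]
      · simp
    have hζ0 : ∀ i, J i ≠ 1 → (∑ l, if i = f l then g l else 0) = 0 := by
      intro i hi
      refine Finset.sum_eq_zero fun l _ => ?_
      rw [if_neg]; rintro rfl; exact hi (hfS l)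
    refine ⟨fun i => ∑ l, if i = f l then g l else 0, ?_, ?_, ?_⟩
    · rw [Finset.sum_comm]
      simp only [Finset.sum_ite_eq', Finset.mem_univ, if_true]
      simpa using g_sum
    · intro i
      by_cases hi : J i = 1
      · obtain ⟨k, rfl⟩ := hsurj i hi
        simp only [hζf]; exact hfz k
      · simp only [hζ0 i hi, hout i hi]; norm_num
    · intro k
      rw [Finset.card_eq_one]
      refine ⟨f k, ?_⟩
      ext i
      simp only [Finset.mem_filter, Finset.mem_univ, true_and, Finset.mem_singleton]
      by_cases hi : J i = 1
      · obtain ⟨l, rfl⟩ := hsurj i hi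
        rw [hζf, ef_g, hi]
        by_cases hkl : k = l
        · simp [hkl]
        · have hne : f l ≠ f k := fun h => hkl (hf h).symm
          simp [hkl, hne]
      · rw [hζ0 i hi, ef_zero, zmod_cases _ hi]
        simp only [ne_eq, not_true_eq_false, false_iff]
        rintro rfl; exact hi (hfS k)

/-- All three functionals tight. -/
lemma all_tight {y : ι → K → ℝ} (hy : y ∈ (Q ι).extremePoints ℝ)
    (h : ∀ k, ∃ I, Tight y k I) : ∃ ξ : ι → K, ∑ i, ξ i = 0 ∧ y = inc ξ := by
  choose I hI using h
  let J : ι → ZMod 2 := fun i => I 0 i + I 1 i + I 2 i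
  have hJ : ∑ i, J i = 1 := by
    simp only [J, Finset.sum_add_distrib, (hI _).1]; decide
  let u : ι → K := fun i => (I 0 i + J i, I 1 i + J i)
  have hu : ∀ k i, ef k (u i) = I k i + J i := by
    have : ∀ a b c : ZMod 2, ∀ k : Fin 3,
      ef k (a + (a + b + c), b + (a + b + c)) = ![a, b, c] k + (a + b + c) := by decide
    intro k i
    have h1 := this (I 0 i) (I 1 i) (I 2 i) k
    have h2 : ![I 0 i, I 1 i, I 2 i] k = I k i := by fin_cases k <;> rfl
    rw [h2] at h1
    exact h1
  have hus : ∑ i, u i = 0 := by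
    have h0 : ∀ p : K, ef 0 p = 0 → ef 1 p = 0 → p = 0 := by decide
    apply h0 <;>
    · rw [ef_sum]; simp only [hu, Finset.sum_add_distrib, (hI _).1, hJ]; decide
  have hzz : ∀ k i, r k (J i) (fun τ => y i (u i + τ)) = r k (I k i) (y i) := by
    intro k i
    unfold r
    refine Fintype.sum_equiv (Equiv.addLeft (u i)) _ _ fun τ => ?_
    simp only [Equiv.coe_addLeft, ef_add, hu]
    have : ∀ a b c : ZMod 2, c = b ↔ a + b + c = a := by decide
    simp only [this (I k i) (J i) (ef k τ)]
  obtain ⟨ζ, h1, h2, h3⟩ := core (fun i τ => y i (u i + τ)) (fun i τ => hy.1.1 _ _)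
    (fun i => by rw [← hy.1.2.1 i]; exact Fintype.sum_equiv (Equiv.addLeft (u i)) _ _ fun τ => rfl)
    J hJ (fun k => by rw [← (hI k).2]; exact Finset.sum_congr rfl fun i _ => hzz k i)
  refine ⟨fun i => u i + ζ i, ?_, extreme_eq_inc hy _ h2 fun k _ => ⟨I k, hI k, ?_⟩⟩
  · rw [Finset.sum_add_distrib, hus, h1, add_zero]
  · rw [← h3 k]
    congr 1
    ext i
    simp only [Finset.mem_filter, Finset.mem_univ, true_and, ef_add, hu]
    have : ∀ a b c : ZMod 2, a + b + c ≠ a ↔ c ≠ b := by decide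
    exact this _ _ _

/-- A functional that is constant on all rows but one is constant there too. -/
lemma solo {y : ι → K → ℝ} (hy : y ∈ Q ι) (k : Fin 3) (i0 : ι) (a : ι → ZMod 2)
    (ha : ∑ i, a i = 0) (h : ∀ i, i ≠ i0 → r k (a i) (y i) = 0) : r k (a i0) (y i0) = 0 := by
  let I : ι → ZMod 2 := Function.update a i0 (a i0 + 1)
  have hIs : ∑ i, I i = 1 := by
    have h1 := Finset.add_sum_erase Finset.univ a (Finset.mem_univ i0)
    rw [← Finset.add_sum_erase Finset.univ I (Finset.mem_univ i0)]
    have h2 : ∑ i ∈ Finset.univ.erase i0, I i = ∑ i ∈ Finset.univ.erase i0, a i :=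
      Finset.sum_congr rfl fun i hi => by simp [I, Finset.ne_of_mem_erase hi]
    rw [h2]
    have : I i0 = a i0 + 1 := by simp [I]
    rw [this, add_right_comm, h1, ha, zero_add]
  have h1 := hy.2.2 k I hIs
  rw [Finset.sum_eq_single i0] at h1
  · have h2 := r_compl k (a i0) (y i0)
    rw [hy.2.1] at h2
    have h3 : I i0 = a i0 + 1 := by simp [I]
    rw [h3] at h1
    have := r_nonneg (k := k) (a := a i0) (hy.1 i0)
    linarith
  · intro i _ hi
    have : I i = a i := by simp [I, hi]
    rw [this]; exact h i hi
  · simp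

lemma solo_const {y : ι → K → ℝ} (hy : y ∈ Q ι) (k : Fin 3) (i0 : ι) (ξ : ι → K)
    (h : ∀ i, i ≠ i0 → r k (ef k (ξ i)) (y i) = 0) (ω ω' : K) (hω : y i0 ω ≠ 0) (hω' : y i0 ω' ≠ 0) :
    ef k ω = ef k ω' := by
  let a : ι → ZMod 2 := fun i => ef k (ξ i)
  let b : ι → ZMod 2 := Function.update a i0 (∑ i ∈ Finset.univ.erase i0, a i)
  have hb : ∑ i, b i = 0 := by
    rw [← Finset.add_sum_erase Finset.univ b (Finset.mem_univ i0)]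
    have h2 : ∑ i ∈ Finset.univ.erase i0, b i = ∑ i ∈ Finset.univ.erase i0, a i :=
      Finset.sum_congr rfl fun i hi => by simp [b, Finset.ne_of_mem_erase hi]
    have h3 : b i0 = ∑ i ∈ Finset.univ.erase i0, a i := by simp [b]
    rw [h2, h3]
    generalize ∑ i ∈ Finset.univ.erase i0, a i = x
    revert x; decide
  have := solo hy k i0 b hb fun i hi => by
    have : b i = a i := by simp [b, hi]
    rw [this]; exact h i hi
  rw [r_eq_zero (hy.1 i0)] at this
  rw [this ω hω, this ω' hω']

lemma all_const {y : ι → K → ℝ} (hy : y ∈ Q ι) (k : Fin 3) (ξ : ι → K)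
    (h : ∀ i, r k (ef k (ξ i)) (y i) = 0) : ef k (∑ i, ξ i) = 0 := by
  by_contra hc
  have h1 : ∑ i, ef k (ξ i) = 1 := by
    rw [← ef_sum]; revert hc; generalize ef k (∑ i, ξ i) = x; revert x; decide
  have := hy.2.2 k _ h1
  simp only [h, Finset.sum_const_zero] at this
  linarith

lemma r_const {y : ι → K → ℝ} (hy : y ∈ Q ι) (k : Fin 3) (ξ : ι → K) (i : ι)
    (h : r k (ef k (ξ i)) (y i) = 0) (b : ZMod 2) :
    r k b (y i) = if ef k (ξ i) = b then 0 else 1 := by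
  split_ifs with hb
  · rw [← hb, h]
  · have h1 := r_compl k (ef k (ξ i)) (y i)
    rw [hy.2.1, h, zero_add] at h1
    rw [z2 b _ (Ne.symm hb), h1]

lemma card_bound {y : ι → K → ℝ} (hy : y ∈ (Q ι).extremePoints ℝ)
    (hnt : ¬ ∀ k, ∃ I, Tight y k I) :
    ∑ i, (Finset.univ.filter fun ω => y i ω ≠ 0).card ≤ Fintype.card ι + 2 := by
  let T := {k : Fin 3 // ∃ I, Tight y k I}
  have hT : Fintype.card T ≤ 2 := by
    have : Fintype.card T < Fintype.card (Fin 3) := by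
      push Not at hnt
      obtain ⟨k, hk⟩ := hnt
      exact Fintype.card_subtype_lt (x := k) (by push Not; exact hk)
    simp at this; omega
  choose I hI using fun k : T => k.2
  let Z := {p : ι × K // y p.1 p.2 = 0}
  let L : (ι × K → ℝ) →ₗ[ℝ] (Z ⊕ ι ⊕ T → ℝ) :=
    { toFun := fun v => Sum.elim (fun p => v p.1) (Sum.elim (fun i => ∑ ω, v (i, ω))
        (fun k => ∑ i, r k.1 (I k i) (fun ω => v (i, ω))))
      map_add' := by
        intro v w; ext x
        rcases x with p | i | k
        · simp
        · simp [Finset.sum_add_distrib]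
        · simp only [Sum.elim_inr, Pi.add_apply]
          rw [← Finset.sum_add_distrib]
          exact Finset.sum_congr rfl fun i _ => r_add _ _ _ _
      map_smul' := by
        intro c v; ext x
        rcases x with p | i | k
        · simp
        · simp [Finset.mul_sum]
        · simp only [Sum.elim_inr, Pi.smul_apply, smul_eq_mul, RingHom.id_apply]
          rw [Finset.mul_sum]
          exact Finset.sum_congr rfl fun i _ => r_smul _ _ _ _ }
  have hL : Function.Injective L := by
    rw [← LinearMap.ker_eq_bot, LinearMap.ker_eq_bot']
    intro v hv
    have hc := fun x => congrFun hv x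
    have : (fun i ω => v (i, ω)) = (0 : ι → K → ℝ) := by
      refine extreme_dir' hy ⟨fun i ω h0 => hc (Sum.inl ⟨(i, ω), h0⟩), fun i => hc (Sum.inr (Sum.inl i))⟩ ?_
      intro k hk
      exact ⟨I ⟨k, hk⟩, hI ⟨k, hk⟩, hc (Sum.inr (Sum.inr ⟨k, hk⟩))⟩
    ext ⟨i, ω⟩
    exact congrFun (congrFun this i) ω
  have hfr := LinearMap.finrank_le_finrank_of_injective hL
  rw [Module.finrank_fintype_fun_eq_card, Module.finrank_fintype_fun_eq_card, Fintype.card_sum,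
    Fintype.card_sum] at hfr
  have h1 : ∑ i, (Finset.univ.filter fun ω => y i ω ≠ 0).card
      = Fintype.card {p : ι × K // ¬ y p.1 p.2 = 0} := by
    rw [Fintype.card_subtype, Finset.card_filter, Fintype.sum_prod_type]
    exact Finset.sum_congr rfl fun i _ => by rw [Finset.card_filter]
  have h2 := Fintype.card_subtype_compl (fun p : ι × K => y p.1 p.2 = 0)
  have h3 := Fintype.card_subtype_le (fun p : ι × K => y p.1 p.2 = 0)
  have h4 : Fintype.card Z = Fintype.card {p : ι × K // y p.1 p.2 = 0} := rfl
  omega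

lemma row_ne {y : ι → K → ℝ} (hy : y ∈ Q ι) (i : ι) : ∃ ω, y i ω ≠ 0 := by
  by_contra hc; push Not at hc
  have := hy.2.1 i
  simp [hc] at this

lemma hfin_aux (k : Fin 3) (a a' σ : K) (h1 : a ≠ a') (h2 : ef k a = ef k a')
    (h3 : ef k (a + σ) = 0) : a + σ = 0 ∨ a' + σ = 0 := by
  have : ∀ (k : Fin 3) (a a' σ : K), a = a' ∨ ef k a ≠ ef k a' ∨ ef k (a + σ) ≠ 0 ∨
    a + σ = 0 ∨ a' + σ = 0 := by decide
  have := this k a a' σ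
  tauto

/-- Not all tight. -/
lemma not_all_tight {y : ι → K → ℝ} (hy : y ∈ (Q ι).extremePoints ℝ)
    (hnt : ¬ ∀ k, ∃ I, Tight y k I) : ∃ ξ : ι → K, ∑ i, ξ i = 0 ∧ y = inc ξ := by
  have hyQ := hy.1
  choose ξ hξ using row_ne hyQ
  have hcard := card_bound hy hnt
  have hsep : ∀ ω ω' : K, ω ≠ ω' → ∃ k, ef k ω ≠ ef k ω' := by decide
  set s : ι → ℕ := fun i => (Finset.univ.filter fun ω => y i ω ≠ 0).card with hs
  have hcard : ∑ i, s i ≤ Fintype.card ι + 2 := hcard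
  have hs1 : ∀ i, 1 ≤ s i := fun i => Finset.card_pos.mpr ⟨ξ i, by simp [hξ i]⟩
  have hone : ∀ i, s i ≤ 1 → ∀ ω, y i ω ≠ 0 → ω = ξ i := by
    intro i hi ω hω
    exact Finset.card_le_one.mp hi ω (by simp [hω]) (ξ i) (by simp [hξ i])
  have honer : ∀ i, s i ≤ 1 → ∀ k, r k (ef k (ξ i)) (y i) = 0 := by
    intro i hi k
    rw [r_eq_zero (hyQ.1 i)]
    intro ω hω; rw [hone i hi ω hω]
  by_cases hall : ∀ i, s i ≤ 1
  · refine ⟨ξ, ?_, ?_⟩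
    · have h0 : ∀ p : K, (∀ k, ef k p = 0) → p = 0 := by decide
      exact h0 _ fun k => all_const hyQ k ξ fun i => honer i (hall i) k
    · ext i ω
      unfold inc
      split_ifs with h
      · have := hyQ.2.1 i
        rw [Finset.sum_eq_single (ξ i)] at this
        · rw [← h, this]
        · intro b _ hb; by_contra hc; exact hb (hone i (hall i) b hc)
        · simp
      · by_contra hc; exact h (hone i (hall i) ω hc).symm
  push Not at hall
  obtain ⟨i0, hi0⟩ := hall
  obtain ⟨a, ha, a', ha', haa⟩ := Finset.one_lt_card.mp hi0
  simp only [Finset.mem_filter, Finset.mem_univ, true_and] at ha ha'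
  have hj : ∃ j, j ≠ i0 ∧ 1 < s j := by
    by_contra hc; push Not at hc
    obtain ⟨k, hk⟩ := hsep a a' haa
    exact hk (solo_const hyQ k i0 ξ (fun i hi => honer i (hc i hi) k) a a' ha ha')
  obtain ⟨j, hji, hj1⟩ := hj
  have hsplit : s i0 + s j + ∑ i ∈ (Finset.univ.erase i0).erase j, s i = ∑ i, s i := by
    rw [add_assoc, Finset.add_sum_erase _ _ (by simp [hji]), Finset.add_sum_erase _ _ (by simp)]
  have hcc : ((Finset.univ.erase i0).erase j).card + 2 = Fintype.card ι := by
    have h1 := Finset.card_erase_add_one (s := Finset.univ.erase i0) (a := j) (by simp [hji])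
    have h2 := Finset.card_erase_add_one (s := Finset.univ) (a := i0) (by simp)
    rw [Finset.card_univ] at h2
    omega
  have hrest_ge : ((Finset.univ.erase i0).erase j).card ≤ ∑ i ∈ (Finset.univ.erase i0).erase j, s i := by
    rw [Finset.card_eq_sum_ones]; exact Finset.sum_le_sum fun i _ => hs1 i
  have hs_i0 : s i0 = 2 := by omega
  have hrest : ∀ i, i ≠ i0 → i ≠ j → s i ≤ 1 := by
    intro i h1 h2
    by_contra hc
    have : ((Finset.univ.erase i0).erase j).card < ∑ i ∈ (Finset.univ.erase i0).erase j, s i := by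
      rw [Finset.card_eq_sum_ones]
      exact Finset.sum_lt_sum (fun i _ => hs1 i) ⟨i, by simp [h1, h2], by omega⟩
    omega
  -- the support of row `i0`
  have hsupp : ∀ ω, y i0 ω ≠ 0 → ω = a ∨ ω = a' := by
    have hsub : ({a, a'} : Finset K) ⊆ Finset.univ.filter fun ω => y i0 ω ≠ 0 := by
      intro x hx; simp at hx; rcases hx with rfl | rfl <;> simp [ha, ha']
    have := Finset.eq_of_subset_of_card_le hsub (by rw [Finset.card_pair haa]; exact hs_i0.le)
    intro ω hω
    have h1 : ω ∈ Finset.univ.filter fun ω => y i0 ω ≠ 0 := by simp [hω]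
    rw [← this] at h1; simpa using h1
  have hk0 : ∀ a a' : K, ∃ k, ef k a = ef k a' := by decide
  obtain ⟨k0, hk0⟩ := hk0 a a'
  have hc_iff : ∀ ξ : ι → K, (∀ i, y i (ξ i) ≠ 0) → ∀ k, ef k a = ef k a' →
      ∀ i, r k (ef k (ξ i)) (y i) = 0 := by
    intro ξ' hξ' k hk
    have hr : ∀ i, i ≠ j → r k (ef k (ξ' i)) (y i) = 0 := by
      intro i hij
      rw [r_eq_zero (hyQ.1 i)]
      intro ω hω
      by_cases hi : i = i0
      · subst hi
        rcases hsupp ω hω with rfl | rfl <;> rcases hsupp _ (hξ' i) with h | h <;> rw [h]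
          <;> simp [hk]
      · rw [hone i (hrest i hi hij) ω hω, hone i (hrest i hi hij) _ (hξ' i)]
    intro i
    by_cases hij : i = j
    · subst hij
      rw [r_eq_zero (hyQ.1 i)]
      intro ω hω
      exact solo_const hyQ k i ξ' hr ω (ξ' i) hω (hξ' i)
    · exact hr i hij
  -- a cyclic one
  have hex : ∃ ζ : ι → K, (∀ i, y i (ζ i) ≠ 0) ∧ ∑ i, ζ i = 0 := by
    let ζ : K → ι → K := fun b => Function.update ξ i0 b
    have hζ : ∀ b, y i0 b ≠ 0 → ∀ i, y i (ζ b i) ≠ 0 := by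
      intro b hb i
      by_cases hi : i = i0
      · subst hi; simpa [ζ] using hb
      · simpa [ζ, hi] using hξ i
    have hsum : ∀ b, ∑ i, ζ b i = b + ∑ i ∈ Finset.univ.erase i0, ξ i := by
      intro b
      rw [← Finset.add_sum_erase Finset.univ (ζ b) (Finset.mem_univ i0)]
      congr 1
      · simp [ζ]
      · exact Finset.sum_congr rfl fun i hi => by simp [ζ, Finset.ne_of_mem_erase hi]
    have h1 := all_const hyQ k0 (ζ a) (hc_iff _ (hζ a ha) k0 hk0)
    rw [hsum] at h1
    rcases hfin_aux k0 a a' _ haa hk0 h1 with h | h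
    · exact ⟨ζ a, hζ a ha, by rw [hsum]; exact h⟩
    · exact ⟨ζ a', hζ a' ha', by rw [hsum]; exact h⟩
  obtain ⟨ζ, hζs, hζ0⟩ := hex
  refine ⟨ζ, hζ0, extreme_eq_inc hy ζ hζs fun k hk => ?_⟩
  obtain ⟨I, hI⟩ := hk
  refine ⟨I, hI, ?_⟩
  by_cases hka : ef k a = ef k a'
  · have h1 := hI.2
    have h2 := cast_count k I ζ
    have h3 : ∑ i, r k (I i) (inc ζ i) = ∑ i, r k (I i) (y i) := by
      refine Finset.sum_congr rfl fun i _ => ?_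
      rw [r_inc, r_const hyQ k ζ i (hc_iff ζ hζs k hka i)]
    rw [h3, h1] at h2
    exact_mod_cast h2.symm
  · have hodd := count_odd k I hI.1 ζ hζ0
    have hrr : ∀ i, i ≠ i0 → i ≠ j → r k (ef k (ζ i)) (y i) = 0 := by
      intro i h1 h2
      rw [hone i (hrest i h1 h2) _ (hζs i)]; exact honer i (hrest i h1 h2) k
    have hpos : 0 < r k (I i0) (y i0) := by
      refine lt_of_le_of_ne (r_nonneg (hyQ.1 i0)) fun h => ?_
      have := (r_eq_zero (hyQ.1 i0)).mp h.symm
      exact hka ((this a ha).trans (this a' ha').symm)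
    have hsub : (Finset.univ.filter fun i => ef k (ζ i) ≠ I i) ⊆ {i0, j} := by
      intro i hi
      simp only [Finset.mem_filter, Finset.mem_univ, true_and] at hi
      by_contra hc
      simp only [Finset.mem_insert, Finset.mem_singleton, not_or] at hc
      have h1 := r_const hyQ k ζ i (hrr i hc.1 hc.2) (I i)
      rw [if_neg hi] at h1
      have h2 : r k (I i) (y i) + r k (I i0) (y i0) ≤ ∑ i, r k (I i) (y i) := by
        rw [← Finset.sum_pair (f := fun i => r k (I i) (y i)) hc.1]
        exact Finset.sum_le_sum_of_subset_of_nonneg (Finset.subset_univ _)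
          fun i _ _ => r_nonneg (hyQ.1 i)
      rw [hI.2] at h2; linarith
    have h2 := (Finset.card_le_card hsub).trans Finset.card_le_two
    obtain ⟨m, hm⟩ := hodd
    omega

theorem Q_sub : Q ι ⊆ convexHull ℝ (inc '' {ξ : ι → K | ∑ i, ξ i = 0}) := by
  have hfin : (inc '' {ξ : ι → K | ∑ i, ξ i = 0}).Finite := (Set.toFinite _).image _
  have hcl : IsClosed (convexHull ℝ (inc '' {ξ : ι → K | ∑ i, ξ i = 0})) :=
    hfin.isClosed_convexHull ℝ
  rw [← closure_convexHull_extremePoints Q_compact Q_convex]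
  refine closure_minimal (convexHull_min ?_ (convex_convexHull ℝ _)) hcl
  intro y hy
  have : ∃ ξ : ι → K, ∑ i, ξ i = 0 ∧ y = inc ξ := by
    by_cases h : ∀ k, ∃ I, Tight y k I
    · exact all_tight hy h
    · exact not_all_tight hy h
  obtain ⟨ξ, h1, rfl⟩ := this
  exact subset_convexHull ℝ _ ⟨ξ, h1, rfl⟩

/-- the linear functional counting expected violations on `F2 1` -/
lemma ctp_odd {n : ℕ} (C : Fin n → Set (F2 1)) (I : Fin n → ZMod 2) (hI : ∑ i, I i = 1)
    (q : Fin n → F2 1 → ℝ) (hq : q ∈ CTP C) :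
    1 ≤ ∑ i, ∑ η : F2 1, if η 0 = I i then 0 else q i η := by
  unfold CTP at hq
  obtain ⟨α, _, w, z, hw, hw1, hz, rfl⟩ := mem_convexHull_iff_exists_fintype.mp hq
  have hz1 : ∀ a, 1 ≤ ∑ i, ∑ η : F2 1, if η 0 = I i then 0 else z a i η := by
    intro a
    obtain ⟨ξ, ⟨_, hξ⟩, h⟩ := hz a
    rw [← h]
    have h1 : ∀ i, (∑ η : F2 1, if η 0 = I i then 0 else incVec ξ i η)
        = if ξ i 0 = I i then (0 : ℝ) else 1 := by
      intro i
      rw [Finset.sum_eq_single (ξ i)]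
      · simp [incVec]
      · intro b _ hb; simp [incVec, Ne.symm hb]
      · simp
    simp only [h1]
    have hex : ∃ i, ξ i 0 ≠ I i := by
      by_contra hc; push Not at hc
      have h2 := congrFun hξ 0
      rw [Finset.sum_apply] at h2
      simp only [hc, hI] at h2
      exact absurd h2 (by decide)
    obtain ⟨i, hi⟩ := hex
    have := Finset.single_le_sum (f := fun i => if ξ i 0 = I i then (0 : ℝ) else 1)
      (fun i _ => by split_ifs <;> norm_num) (Finset.mem_univ i)
    simpa [hi] using this
  have h2 : (∑ i, ∑ η : F2 1, if η 0 = I i then 0 else (∑ a, w a • z a) i η)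
      = ∑ a, w a * ∑ i, ∑ η : F2 1, if η 0 = I i then 0 else z a i η := by
    simp only [Finset.mul_sum]
    symm
    rw [Finset.sum_comm]
    refine Finset.sum_congr rfl fun i _ => ?_
    rw [Finset.sum_comm]
    refine Finset.sum_congr rfl fun η _ => ?_
    split_ifs
    · simp
    · simp [Finset.sum_apply]
  rw [h2]
  calc (1 : ℝ) = ∑ a, w a := hw1.symm
    _ ≤ _ := Finset.sum_le_sum fun a _ => le_mul_of_one_le_right (hw a) (hz1 a)

/-- pushing sums along a map -/
lemma push_sum {α β : Type*} [Fintype α] [Fintype β] [DecidableEq β] (ψ : α → β) (x : α → ℝ)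
    (P : β → Prop) [DecidablePred P] :
    (∑ p, if P p then ∑ ω, (if ψ ω = p then x ω else 0) else 0)
      = ∑ ω, if P (ψ ω) then x ω else 0 := by
  have : ∀ p, (if P p then ∑ ω, (if ψ ω = p then x ω else 0) else 0)
      = ∑ ω, if ψ ω = p then (if P (ψ ω) then x ω else 0) else 0 := by
    intro p
    split_ifs with h
    · refine Finset.sum_congr rfl fun ω _ => ?_
      split_ifs with h1 h2
      · rfl
      · rw [h1] at h2; exact absurd h h2
      · rfl
    · symm
      refine Finset.sum_eq_zero fun ω _ => ?_
      split_ifs with h1 h2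
      · rw [h1] at h2; exact absurd h2 h
      · rfl
      · rfl
  simp only [this]
  rw [Finset.sum_comm]
  simp

lemma indMap_eq {d d' n : ℕ} {B : Fin n → Set (F2 d)} (φ : F2 d →ₗ[ZMod 2] F2 d')
    {x : Fin n → F2 d → ℝ} (hx : x ∈ TP B) (i : Fin n) (η : F2 d') :
    indMap B φ x i η = ∑ ω, if φ ω = η then x i ω else 0 := by
  unfold indMap
  rw [Finset.sum_filter]
  refine Finset.sum_congr rfl fun ω _ => ?_
  by_cases h1 : ω ∈ B i
  · simp [h1]
  · simp [h1, hx.2.1 i ω h1]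

theorem main {d n : ℕ} (B : Fin n → Set (F2 d)) (x : Fin n → F2 d → ℝ) (hx : x ∈ RPr B 1)
    (d' : ℕ) (φ : F2 d →ₗ[ZMod 2] F2 d') (hφ : Module.finrank (ZMod 2) (LinearMap.range φ) ≤ 2) :
    x ∈ RP B φ := by
  simp only [RPr, Set.mem_iInter] at hx
  have hTP : x ∈ TP B := by
    refine (hx 1 0 ?_).1
    exact (Submodule.finrank_le _).trans (by simp)
  refine ⟨hTP, ?_⟩
  have hK : Module.finrank (ZMod 2) K = 2 := by simp [K]
  obtain ⟨f, hf⟩ := (finrank_le_iff_exists_linearMap (R := ZMod 2)).mp (hφ.trans hK.ge)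
  obtain ⟨f', hf'⟩ := LinearMap.exists_leftInverse_of_injective f (LinearMap.ker_eq_bot.mpr hf)
  let ψ : F2 d →ₗ[ZMod 2] K := f ∘ₗ φ.rangeRestrict
  let h : K →ₗ[ZMod 2] F2 d' := (LinearMap.range φ).subtype ∘ₗ f'
  have hψ : ∀ ω, h (ψ ω) = φ ω := by
    intro ω
    have := LinearMap.congr_fun hf' (φ.rangeRestrict ω)
    simp only [LinearMap.comp_apply, LinearMap.id_apply] at this
    simp [h, ψ, this]
  let y : Fin n → K → ℝ := fun i p => ∑ ω, if ψ ω = p then x i ω else 0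
  have hyQ : y ∈ Q (Fin n) := by
    refine ⟨fun i p => ?_, fun i => ?_, fun k I hI => ?_⟩
    · exact Finset.sum_nonneg fun ω _ => by split_ifs <;> simp [hTP.1]
    · have := push_sum ψ (x i) (fun _ => True)
      simp only [if_true] at this
      rw [← hTP.2.2 i]; exact this
    · let φ1 : F2 d →ₗ[ZMod 2] F2 1 := LinearMap.pi fun _ => eL k ∘ₗ ψ
      have hφ1 : ∀ ω, φ1 ω 0 = ef k (ψ ω) := fun ω => rfl
      have h1 := (hx 1 φ1 ((Submodule.finrank_le _).trans (by simp))).2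
      have h2 := ctp_odd _ I hI _ h1
      refine h2.trans (le_of_eq (Finset.sum_congr rfl fun i _ => ?_))
      unfold r
      have e1 := push_sum φ1 (x i) (fun η => ¬ η 0 = I i)
      have e2 := push_sum ψ (x i) (fun p => ¬ ef k p = I i)
      simp only [hφ1] at e1
      simp only [ite_not] at e1 e2
      simp only [indMap_eq φ1 hTP]
      exact e1.trans e2.symm
  obtain ⟨α, _, w, z, hw, hw1, hz, hzy⟩ := mem_convexHull_iff_exists_fintype.mp (Q_sub hyQ)
  choose ξ hξ0 hξ using hz
  have hyw : ∀ i p, y i p = ∑ a, if ξ a i = p then w a else 0 := by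
    intro i p
    rw [← hzy, Finset.sum_apply, Finset.sum_apply]
    refine Finset.sum_congr rfl fun a _ => ?_
    rw [← hξ a]; simp [inc]
  have hfinal : indMap B φ x = ∑ a ∈ Finset.univ.filter (fun a => w a ≠ 0),
      w a • incVec (fun i => h (ξ a i)) := by
    have e0 : ∑ a ∈ Finset.univ.filter (fun a => w a ≠ 0), w a • incVec (fun i => h (ξ a i))
        = ∑ a, w a • incVec (fun i => h (ξ a i)) := by
      refine Finset.sum_subset (Finset.subset_univ _) fun a _ ha => ?_
      have : w a = 0 := by simpa using ha
      simp [this]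
    rw [e0]
    ext i η
    rw [indMap_eq φ hTP, Finset.sum_apply, Finset.sum_apply]
    have e1 := push_sum ψ (x i) (fun p => h p = η)
    have e2 := push_sum (fun a => ξ a i) w (fun p => h p = η)
    simp only [hψ] at e1
    rw [← e1]
    have e3 : (∑ a, (w a • incVec fun i => h (ξ a i)) i η) = ∑ a, if h (ξ a i) = η then w a else 0 := by
      refine Finset.sum_congr rfl fun a _ => ?_
      simp [incVec]
    rw [e3, ← e2]
    refine Finset.sum_congr rfl fun p _ => ?_
    have := hyw i p
    simp only [y] at this
    rw [this]
  rw [hfinal]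
  refine (convex_convexHull ℝ _).sum_mem (fun a _ => hw a) ?_ fun a ha => subset_convexHull ℝ _ ⟨_, ⟨fun i => ?_, ?_⟩, rfl⟩
  · rw [← hw1]
    exact Finset.sum_subset (Finset.subset_univ _) fun a _ ha => by simpa using ha
  · have ha0 : w a ≠ 0 := by simpa using ha
    have hpos : 0 < w a := lt_of_le_of_ne (hw a) (Ne.symm ha0)
    have hyp : y i (ξ a i) ≠ 0 := by
      rw [hyw]
      have := Finset.single_le_sum (f := fun b => if ξ b i = ξ a i then w b else 0)
        (fun b _ => by split_ifs <;> simp [hw]) (Finset.mem_univ a)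
      simp only [if_true] at this
      exact ne_of_gt (lt_of_lt_of_le hpos this)
    obtain ⟨ω, _, hω⟩ := Finset.exists_ne_zero_of_sum_ne_zero hyp
    have h1 : ψ ω = ξ a i := by by_contra hc; simp [hc] at hω
    have h2 : x i ω ≠ 0 := by simpa [h1] using hω
    refine ⟨ω, ?_, ?_⟩
    · by_contra hc; exact h2 (hTP.2.1 i ω hc)
    · rw [← hψ, h1]
  · rw [← map_sum, hξ0 a, map_zero]

end CT

/-- the rank-2 relaxation coincides with the rank-1 relaxation. -/
theorem statement19 (d n : ℕ) (hn : 2 ≤ n) (B : Fin n → Set (F2 d))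
    (hB : ∀ i, (B i).Nonempty) :
    RPr B 2 = RPr B 1 := by
  apply Set.Subset.antisymm
  · intro x hx
    simp only [RPr, Set.mem_iInter] at hx ⊢
    intro d' φ hφ
    exact hx d' φ (hφ.trans (by norm_num))
  · intro x hx
    have := CT.main B x hx
    simp only [RPr, Set.mem_iInter]
    exact this
end
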